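/- arXiv:1411.5673 — 7 statements merged into one kernel-verified Lean document; each statement's English description precedes it below -/
import Mathlib

section
/- There exists a constant C > 0, depending only on h, such that for every δ ∈ (−1,1): (i) |g_r(ℓ) − ℓ| ≤ C·|δ|·(ℓ+1) for all r ∈ (0,1/2) and all ℓ ∈ [−1,0]; and (ii) sup over r ∈ (0,1/2) and θ ∈ [−1,0)∪(0,1] of |∂g_r(θ)/∂θ − 1| is at most C·|δ|. -/
open MeasureTheory Set Filter

noncomputable section

/-- The hypotheses on the auxiliary function `h : [0,1/2) → [0,∞)`. -/
def GoodH (h : ℝ → ℝ) : Prop :=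
  (∀ r ∈ Set.Ico (0:ℝ) (1/2), 0 ≤ h r) ∧
  MonotoneOn h (Set.Ico (0:ℝ) (1/2)) ∧
  (∀ r ∈ Set.Icc (0:ℝ) (1/10), h r = 0) ∧
  Filter.Tendsto h (nhdsWithin (1/2 : ℝ) (Set.Iio (1/2 : ℝ))) Filter.atTop ∧
  ContDiffOn ℝ 3 h (Set.Ico (0:ℝ) (1/2)) ∧
  ∃ c : ℝ, ∀ r ∈ Set.Ico (0:ℝ) (1/2),
    (deriv h r) ^ 2 ≤ c * (r + h r) ^ 3 ∧
    deriv (deriv h) r * deriv h r ≤ c * (r + h r) ^ 3 ∧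
    |deriv (deriv (deriv h)) r| ≤ c * (r + h r) ^ 2

/-- The defining property of the angle function `Θ`. -/
def GoodTheta (h : ℝ → ℝ) (r₀ : ℝ) (Θ : ℝ → ℝ) : Prop :=
  (∀ r : ℝ, 0 < r → r ≤ r₀ → Θ r = Real.arccos (h r / (h r + r))) ∧
  (∀ r : ℝ, r₀ < r → r < 1/2 → Θ r = Real.arcsin (1 / (2 * (h r + r))))

/-- The weight function `w_r(θ) = 1 + h'(r) − h'(r) cos(θ Θ(r))`. -/
def wgt (h Θ : ℝ → ℝ) (r θ : ℝ) : ℝ :=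
  1 + deriv h r - deriv h r * Real.cos (θ * Θ r)

/-- The defining properties of the family of stretching bijections `g_r`. -/
def IsGFamily (h Θ : ℝ → ℝ) (δ : ℝ) (g : ℝ → ℝ → ℝ) : Prop :=
  ∀ r ∈ Set.Ioo (0:ℝ) (1/2),
    StrictMonoOn (g r) (Set.Icc (-1:ℝ) 1) ∧
    Set.BijOn (g r) (Set.Icc (-1:ℝ) 1) (Set.Icc (-1:ℝ) 1) ∧
    g r (-1) = -1 ∧ g r 1 = 1 ∧
    (∀ ℓ ∈ Set.Icc (-1:ℝ) 0,
      (1 + δ) * ∫ θ in (-1:ℝ)..ℓ, wgt h Θ r θ = ∫ θ in (-1:ℝ)..(g r ℓ), wgt h Θ r θ) ∧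
    (∀ ℓ ∈ Set.Icc (0:ℝ) 1,
      (1 - δ) * ∫ θ in ℓ..(1:ℝ), wgt h Θ r θ = ∫ θ in (g r ℓ)..(1:ℝ), wgt h Θ r θ)

theorem aux_bound (h : ℝ → ℝ) (hh : GoodH h)
    (r₀ : ℝ) (hr₀ : r₀ ∈ Set.Ioo (0:ℝ) (1/2)) (hr₀eq : 2 * r₀ * h r₀ + r₀ ^ 2 = 1/4)
    (Θ : ℝ → ℝ) (hΘ : GoodTheta h r₀ Θ) :
    ∃ M : ℝ, 0 ≤ M ∧ ∀ r ∈ Set.Ioo (0:ℝ) (1/2),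
      0 ≤ deriv h r ∧ deriv h r * Θ r ^ 2 ≤ M := by
  obtain ⟨h0, hmono, -, -, -, c, hc⟩ := hh
  have hr₀' : r₀ ∈ Set.Ico (0:ℝ) (1/2) := ⟨hr₀.1.le, hr₀.2⟩
  have hA : 0 ≤ |c| * (r₀ + h r₀) ^ 3 :=
    mul_nonneg (abs_nonneg _) (pow_nonneg (add_nonneg hr₀.1.le (h0 _ hr₀')) 3)
  have hpi : Real.pi / 2 ≤ 2 := by linarith [Real.pi_le_four]
  refine ⟨4 * (1 + |c| * (r₀ + h r₀) ^ 3) + (1 + 2 * |c|), by positivity, ?_⟩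
  intro r hr
  have hr' : r ∈ Set.Ico (0:ℝ) (1/2) := ⟨hr.1.le, hr.2⟩
  have hd : 0 ≤ deriv h r := by
    have h1 := hmono.derivWithin_nonneg (x := r)
    rwa [derivWithin_of_mem_nhds (Ico_mem_nhds hr.1 hr.2)] at h1
  refine ⟨hd, ?_⟩
  have hs : 0 < r + h r := by linarith [hr.1, h0 r hr']
  have h2 : (deriv h r) ^ 2 ≤ |c| * (r + h r) ^ 3 :=
    (hc r hr').1.trans (mul_le_mul_of_nonneg_right (le_abs_self c) (by positivity))
  rcases le_or_gt r r₀ with hle | hlt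
  · have e := hΘ.1 r hr.1 hle
    have t0 : 0 ≤ Θ r := by rw [e]; exact Real.arccos_nonneg _
    have t1 : Θ r ≤ 2 := by
      rw [e]
      refine le_trans (Real.arccos_le_pi_div_two.2 ?_) hpi
      exact div_nonneg (h0 r hr') (by linarith)
    have h3 : (deriv h r) ^ 2 ≤ |c| * (r₀ + h r₀) ^ 3 := by
      refine h2.trans (mul_le_mul_of_nonneg_left ?_ (abs_nonneg c))
      exact pow_le_pow_left₀ hs.le (add_le_add hle (hmono hr' hr₀' hle)) 3
    have h4 : deriv h r ≤ 1 + |c| * (r₀ + h r₀) ^ 3 := by nlinarith [sq_nonneg (deriv h r - 1)]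
    have h5 : Θ r ^ 2 ≤ 4 := by nlinarith
    have h6 : deriv h r * Θ r ^ 2 ≤ (1 + |c| * (r₀ + h r₀) ^ 3) * 4 :=
      mul_le_mul h4 h5 (sq_nonneg _) (by positivity)
    linarith [abs_nonneg c]
  · have e := hΘ.2 r hlt hr.2
    have hh0 := h0 _ hr₀'
    have s0 : 1/2 ≤ r₀ + h r₀ := by nlinarith [hr₀.1, sq_nonneg (h r₀)]
    have s1 : 1/2 ≤ r + h r := s0.trans (add_le_add hlt.le (hmono hr₀' hr' hlt.le))
    have y0 : 0 ≤ 1 / (2 * (h r + r)) := by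
      apply div_nonneg zero_le_one; linarith
    have y1 : 1 / (2 * (h r + r)) ≤ 1 := by
      rw [div_le_one (by linarith)]; linarith
    have t0 : 0 ≤ Θ r := by rw [e]; exact Real.arcsin_nonneg.2 y0
    have t1 : Θ r ≤ Real.pi / 2 := by rw [e]; exact Real.arcsin_le_pi_div_two _
    have t2 := Real.mul_le_sin t0 t1
    have t3 : Real.sin (Θ r) = 1 / (2 * (h r + r)) := by
      rw [e, Real.sin_arcsin (by linarith) y1]
    rw [t3] at t2
    have t4 : Θ r * (r + h r) ≤ 1 := by
      have p := Real.pi_pos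
      have : 2 / Real.pi * Θ r * (2 * (h r + r)) ≤ 1 := by
        rwa [le_div_iff₀ (by linarith)] at t2
      have q : 2 / Real.pi * Θ r * (2 * (h r + r)) = 4 * (Θ r * (r + h r)) / Real.pi := by
        field_simp; ring
      rw [q, div_le_one p] at this
      linarith [Real.pi_le_four]
    have u0 : 0 ≤ Θ r * (r + h r) := mul_nonneg t0 hs.le
    have t5 : (Θ r * (r + h r)) ^ 3 ≤ 1 := pow_le_one₀ u0 t4
    have t6 : Θ r ≤ 2 := t1.trans hpi
    have key : (deriv h r * Θ r ^ 2) ^ 2 ≤ 2 * |c| := by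
      calc (deriv h r * Θ r ^ 2) ^ 2 = deriv h r ^ 2 * Θ r ^ 4 := by ring
        _ ≤ |c| * (r + h r) ^ 3 * Θ r ^ 4 := mul_le_mul_of_nonneg_right h2 (by positivity)
        _ = |c| * ((Θ r * (r + h r)) ^ 3 * Θ r) := by ring
        _ ≤ |c| * (1 * 2) := by
            refine mul_le_mul_of_nonneg_left ?_ (abs_nonneg c)
            exact mul_le_mul t5 t6 t0 zero_le_one
        _ = 2 * |c| := by ring
    nlinarith [sq_nonneg (deriv h r * Θ r ^ 2 - 1)]

theorem aux_expand {w : ℝ → ℝ} (hw : Continuous w) (h1 : ∀ x, 1 ≤ w x) (x y : ℝ) :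
    |y - x| ≤ |∫ t in x..y, w t| := by
  wlog hxy : x ≤ y generalizing x y
  · rw [intervalIntegral.integral_symm, abs_neg, abs_sub_comm]
    exact this y x (by linarith)
  have : ∫ t in x..y, (1:ℝ) ≤ ∫ t in x..y, w t :=
    intervalIntegral.integral_mono_on hxy (by simp) (hw.intervalIntegrable _ _) (fun t _ => h1 t)
  rw [abs_of_nonneg (by linarith)]
  simp at this
  exact le_trans (by linarith) (le_abs_self _)

theorem aux_deriv {w : ℝ → ℝ} (hw : Continuous w) (h1 : ∀ x, 1 ≤ w x)
    {g : ℝ → ℝ} {s : Set ℝ} {θ a k : ℝ}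
    (he : ∀ᶠ x in nhdsWithin θ s, (∫ t in (0:ℝ)..(g x), w t) = a + k * ∫ t in (0:ℝ)..x, w t)
    (hθ : (∫ t in (0:ℝ)..(g θ), w t) = a + k * ∫ t in (0:ℝ)..θ, w t) :
    HasDerivWithinAt g (k * w θ / w (g θ)) s θ := by
  set F : ℝ → ℝ := fun x => ∫ t in (0:ℝ)..x, w t with hF
  have hd : ∀ x, HasStrictDerivAt F (w x) x := fun x => hw.integral_hasStrictDerivAt 0 x
  have hne : w (g θ) ≠ 0 := by linarith [h1 (g θ)]
  have hcont : Tendsto g (nhdsWithin θ s) (nhds (g θ)) := by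
    rw [tendsto_iff_dist_tendsto_zero]
    have lim : Tendsto (fun x => |(a + k * F x) - (a + k * F θ)|) (nhdsWithin θ s) (nhds 0) := by
      have hc : Continuous F := continuous_iff_continuousAt.2 fun x => (hd x).hasDerivAt.continuousAt
      have : Continuous (fun x => |(a + k * F x) - (a + k * F θ)|) := by fun_prop
      have h2 := (this.tendsto θ).mono_left (nhdsWithin_le_nhds (s := s))
      simpa using h2
    refine squeeze_zero' (Eventually.of_forall fun _ => dist_nonneg) ?_ lim
    filter_upwards [he] with x hx
    rw [← hθ, ← hx, Real.dist_eq]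
    have h3 := aux_expand hw h1 (g θ) (g x)
    rwa [← intervalIntegral.integral_interval_sub_left (hw.intervalIntegrable 0 _)
      (hw.intervalIntegrable 0 _)] at h3
  have hl := (hd (g θ)).hasStrictFDerivAt_equiv hne
  have hinv := (hd (g θ)).to_localInverse hne
  set φ := (hd (g θ)).localInverse F (w (g θ)) (g θ) hne with hφ
  have hleft : ∀ᶠ y in nhds (g θ), φ (F y) = y := hl.eventually_left_inverse
  have hev := hcont.eventually hleft
  have hcomp : HasDerivWithinAt (fun x => φ (a + k * F x)) ((w (g θ))⁻¹ * (k * w θ)) s θ := by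
    have hi : HasDerivAt φ (w (g θ))⁻¹ (a + k * F θ) := by
      rw [← hθ]; exact hinv.hasDerivAt
    have ho : HasDerivWithinAt (fun x => a + k * F x) (k * w θ) s θ :=
      (((hd θ).hasDerivAt.const_mul k).const_add a).hasDerivWithinAt
    exact hi.comp_hasDerivWithinAt θ ho
  have : k * w θ / w (g θ) = (w (g θ))⁻¹ * (k * w θ) := by rw [div_eq_mul_inv, mul_comm]
  rw [this]
  refine hcomp.congr_of_eventuallyEq ?_ ?_
  · filter_upwards [he, hev] with x hx hx2
    rw [← hx]; exact hx2.symm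
  · rw [← hθ]; exact hleft.self_of_nhds.symm

theorem aux_final {a b d δ M k : ℝ} (hM : 0 ≤ M) (ha : 1 ≤ a) (haM : a ≤ 1 + M) (hb : 1 ≤ b)
    (hk : |k - 1| ≤ |δ|) (hab : |a - b| ≤ M * d) (hd : d ≤ (1 + M) * |δ|) :
    |k * a / b - 1| ≤ (1 + M) ^ 2 * |δ| := by
  have e : k * a / b - 1 = ((k - 1) * a + (a - b)) / b := by
    field_simp; ring
  rw [e, abs_div, abs_of_pos (by linarith : 0 < b), div_le_iff₀ (by linarith)]
  have h1 : |(k - 1) * a + (a - b)| ≤ |k - 1| * a + |a - b| := by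
    refine (abs_add_le _ _).trans ?_
    rw [abs_mul, abs_of_pos (by linarith : 0 < a)]
  have h2 : |k - 1| * a ≤ |δ| * (1 + M) := mul_le_mul hk haM (by linarith) (abs_nonneg _)
  have h3 : M * d ≤ M * ((1 + M) * |δ|) := mul_le_mul_of_nonneg_left hd hM
  have h4 : 0 ≤ (1 + M) ^ 2 * |δ| := by positivity
  nlinarith

theorem stmt_7 (h : ℝ → ℝ) (hh : GoodH h)
    (r₀ : ℝ) (hr₀ : r₀ ∈ Set.Ioo (0:ℝ) (1/2)) (hr₀eq : 2 * r₀ * h r₀ + r₀ ^ 2 = 1/4)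
    (Θ : ℝ → ℝ) (hΘ : GoodTheta h r₀ Θ) :
    ∃ C : ℝ, 0 < C ∧
      ∀ δ ∈ Set.Ioo (-1:ℝ) 1, ∀ g : ℝ → ℝ → ℝ, IsGFamily h Θ δ g →
        (∀ r ∈ Set.Ioo (0:ℝ) (1/2), ∀ ℓ ∈ Set.Icc (-1:ℝ) 0,
          |g r ℓ - ℓ| ≤ C * |δ| * (ℓ + 1)) ∧
        (∀ r ∈ Set.Ioo (0:ℝ) (1/2), ∀ θ ∈ Set.Icc (-1:ℝ) 1, θ ≠ 0 →
          DifferentiableWithinAt ℝ (g r) (Set.Icc (-1:ℝ) 1) θ ∧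
          |derivWithin (g r) (Set.Icc (-1:ℝ) 1) θ - 1| ≤ C * |δ|) := by
  obtain ⟨M, hM, hb⟩ := aux_bound h hh r₀ hr₀ hr₀eq Θ hΘ
  refine ⟨(1 + M) ^ 2, by positivity, ?_⟩
  intro δ hδ g hg
  have hw : ∀ r, Continuous (wgt h Θ r) := by
    intro r; unfold wgt; fun_prop
  have h1 : ∀ r ∈ Set.Ioo (0:ℝ) (1/2), ∀ x, 1 ≤ wgt h Θ r x := by
    intro r hr x
    unfold wgt
    nlinarith [(hb r hr).1, Real.cos_le_one (x * Θ r)]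
  have h2 : ∀ r ∈ Set.Ioo (0:ℝ) (1/2), ∀ x ∈ Set.Icc (-1:ℝ) 1, wgt h Θ r x ≤ 1 + M := by
    intro r hr x hx
    unfold wgt
    obtain ⟨b1, b2⟩ := hb r hr
    have b3 := Real.one_sub_sq_div_two_le_cos (x := x * Θ r)
    have b4 : 1 - Real.cos (x * Θ r) ≤ Θ r ^ 2 := by
      have : x ^ 2 ≤ 1 := by nlinarith [hx.1, hx.2]
      nlinarith [sq_nonneg (Θ r)]
    nlinarith
  have h3 : ∀ r ∈ Set.Ioo (0:ℝ) (1/2), ∀ x ∈ Set.Icc (-1:ℝ) 1, ∀ y ∈ Set.Icc (-1:ℝ) 1,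
      |wgt h Θ r x - wgt h Θ r y| ≤ M * |y - x| := by
    intro r hr x hx y hy
    obtain ⟨b1, b2⟩ := hb r hr
    have e : wgt h Θ r x - wgt h Θ r y
        = deriv h r * (Real.cos (y * Θ r) - Real.cos (x * Θ r)) := by unfold wgt; ring
    rw [e, abs_mul, abs_of_nonneg b1, Real.cos_sub_cos, abs_mul, abs_mul]
    have s1 := Real.abs_sin_le_abs (x := (y * Θ r + x * Θ r) / 2)
    have s2 := Real.abs_sin_le_abs (x := (y * Θ r - x * Θ r) / 2)
    have s3 : |(y * Θ r + x * Θ r) / 2| ≤ |Θ r| := by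
      rw [show (y * Θ r + x * Θ r) / 2 = ((y + x) / 2) * Θ r by ring, abs_mul]
      refine mul_le_of_le_one_left (abs_nonneg _) ?_
      rw [abs_le]; constructor <;> linarith [hx.1, hx.2, hy.1, hy.2]
    have s4 : |(y * Θ r - x * Θ r) / 2| = |y - x| * |Θ r| / 2 := by
      rw [show (y * Θ r - x * Θ r) / 2 = (y - x) * Θ r / 2 by ring, abs_div, abs_mul]; norm_num
    rw [s4] at s2
    have s5 := mul_le_mul (s1.trans s3) s2 (abs_nonneg _) (abs_nonneg _)
    have s6 : |(-2:ℝ)| = 2 := by norm_num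
    rw [s6]
    calc _ = deriv h r * 2 * (|Real.sin ((y * Θ r + x * Θ r) / 2)| *
              |Real.sin ((y * Θ r - x * Θ r) / 2)|) := by ring
      _ ≤ deriv h r * 2 * (|Θ r| * (|y - x| * |Θ r| / 2)) :=
            mul_le_mul_of_nonneg_left s5 (by positivity)
      _ = deriv h r * |Θ r| ^ 2 * |y - x| := by ring
      _ = deriv h r * Θ r ^ 2 * |y - x| := by rw [sq_abs]
      _ ≤ _ := mul_le_mul_of_nonneg_right b2 (abs_nonneg _)
  have hint : ∀ r ∈ Set.Ioo (0:ℝ) (1/2), ∀ x y : ℝ, -1 ≤ x → x ≤ y → y ≤ 1 →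
      |∫ t in x..y, wgt h Θ r t| ≤ (1 + M) * (y - x) := by
    intro r hr x y hx hxy hy
    have := intervalIntegral.norm_integral_le_of_norm_le_const (a := x) (b := y) (C := 1 + M)
      (f := wgt h Θ r) (by
        intro t ht
        rw [uIoc_of_le hxy] at ht
        rw [Real.norm_eq_abs, abs_of_nonneg (by linarith [h1 r hr t])]
        exact h2 r hr t ⟨by linarith [ht.1], by linarith [ht.2]⟩)
    rwa [Real.norm_eq_abs, abs_of_nonneg (by linarith : 0 ≤ y - x)] at this
  have hii : ∀ r a b, IntervalIntegrable (wgt h Θ r) volume a b :=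
    fun r a b => (hw r).intervalIntegrable a b
  have hL : ∀ r ∈ Set.Ioo (0:ℝ) (1/2), ∀ ℓ ∈ Set.Icc (-1:ℝ) 0,
      |g r ℓ - ℓ| ≤ (1 + M) * |δ| * (ℓ + 1) := by
    intro r hr ℓ hℓ
    obtain ⟨-, -, -, -, gl, -⟩ := hg r hr
    have e1 := gl ℓ hℓ
    have e2 := aux_expand (hw r) (h1 r hr) ℓ (g r ℓ)
    have e3 := intervalIntegral.integral_interval_sub_left (hii r (-1) (g r ℓ)) (hii r (-1) ℓ)
    have e4 : ∫ t in ℓ..(g r ℓ), wgt h Θ r t = δ * ∫ t in (-1:ℝ)..ℓ, wgt h Θ r t := by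
      rw [← e3, ← e1]; ring
    rw [e4, abs_mul] at e2
    have e5 := hint r hr (-1) ℓ le_rfl hℓ.1 (by linarith [hℓ.2])
    have e6 := mul_le_mul_of_nonneg_left e5 (abs_nonneg δ)
    linarith
  have hR : ∀ r ∈ Set.Ioo (0:ℝ) (1/2), ∀ ℓ ∈ Set.Icc (0:ℝ) 1,
      |g r ℓ - ℓ| ≤ (1 + M) * |δ| * (1 - ℓ) := by
    intro r hr ℓ hℓ
    obtain ⟨-, -, -, -, -, gr⟩ := hg r hr
    have e1 := gr ℓ hℓ
    have e2 := aux_expand (hw r) (h1 r hr) ℓ (g r ℓ)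
    have e3 := intervalIntegral.integral_add_adjacent_intervals (hii r ℓ (g r ℓ)) (hii r (g r ℓ) 1)
    have e4 : ∫ t in ℓ..(g r ℓ), wgt h Θ r t = δ * ∫ t in ℓ..(1:ℝ), wgt h Θ r t := by
      linarith
    rw [e4, abs_mul] at e2
    have e5 := hint r hr ℓ 1 (by linarith [hℓ.1]) hℓ.2 le_rfl
    have e6 := mul_le_mul_of_nonneg_left e5 (abs_nonneg δ)
    linarith
  refine ⟨?_, ?_⟩
  · intro r hr ℓ hℓ
    refine (hL r hr ℓ hℓ).trans ?_
    have : 0 ≤ ℓ + 1 := by linarith [hℓ.1]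
    refine mul_le_mul_of_nonneg_right (mul_le_mul_of_nonneg_right ?_ (abs_nonneg δ)) this
    nlinarith
  · intro r hr θ hθ hne
    obtain ⟨-, hbij, -, -, gl, gr⟩ := hg r hr
    have hgθ := hbij.mapsTo hθ
    have huniq : UniqueDiffWithinAt ℝ (Set.Icc (-1:ℝ) 1) θ :=
      uniqueDiffOn_Icc (by norm_num) θ hθ
    have hP : 0 ≤ (1 + M) * |δ| := by positivity
    rcases lt_or_gt_of_ne hne with hneg | hpos
    · have key : ∀ x ∈ Set.Icc (-1:ℝ) 0, (∫ t in (0:ℝ)..(g r x), wgt h Θ r t)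
          = (δ * ∫ t in (-1:ℝ)..0, wgt h Θ r t) + (1 + δ) * ∫ t in (0:ℝ)..x, wgt h Θ r t := by
        intro x hx
        have e1 := gl x hx
        rw [← intervalIntegral.integral_add_adjacent_intervals (hii r (-1) 0) (hii r 0 x),
          ← intervalIntegral.integral_add_adjacent_intervals (hii r (-1) 0) (hii r 0 (g r x))] at e1
        linarith
      have hD := aux_deriv (hw r) (h1 r hr) (s := Set.Icc (-1:ℝ) 1) (θ := θ) (g := g r)
        (a := δ * ∫ t in (-1:ℝ)..0, wgt h Θ r t) (k := 1 + δ) (by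
          filter_upwards [self_mem_nhdsWithin, mem_nhdsWithin_of_mem_nhds (Iio_mem_nhds hneg)]
            with x hx hx2
          exact key x ⟨hx.1, le_of_lt hx2⟩) (key θ ⟨hθ.1, hneg.le⟩)
      refine ⟨hD.differentiableWithinAt, ?_⟩
      rw [hD.derivWithin huniq]
      refine aux_final hM (h1 r hr _) (h2 r hr _ hθ) (h1 r hr _) (by simp)
        (h3 r hr θ hθ _ hgθ) ?_
      refine (hL r hr θ ⟨hθ.1, hneg.le⟩).trans ?_
      exact mul_le_of_le_one_right hP (by linarith)
    · have key : ∀ x ∈ Set.Icc (0:ℝ) 1, (∫ t in (0:ℝ)..(g r x), wgt h Θ r t)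
          = (δ * ∫ t in (0:ℝ)..1, wgt h Θ r t) + (1 - δ) * ∫ t in (0:ℝ)..x, wgt h Θ r t := by
        intro x hx
        have e1 := gr x hx
        have e2 := intervalIntegral.integral_add_adjacent_intervals (hii r 0 x) (hii r x 1)
        have e3 := intervalIntegral.integral_add_adjacent_intervals (hii r 0 (g r x))
          (hii r (g r x) 1)
        have e4 : ∫ t in x..1, wgt h Θ r t
            = (∫ t in (0:ℝ)..1, wgt h Θ r t) - ∫ t in (0:ℝ)..x, wgt h Θ r t := by linarith
        rw [e4] at e1
        linarith
      have hD := aux_deriv (hw r) (h1 r hr) (s := Set.Icc (-1:ℝ) 1) (θ := θ) (g := g r)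
        (a := δ * ∫ t in (0:ℝ)..1, wgt h Θ r t) (k := 1 - δ) (by
          filter_upwards [self_mem_nhdsWithin, mem_nhdsWithin_of_mem_nhds (Ioi_mem_nhds hpos)]
            with x hx hx2
          exact key x ⟨le_of_lt hx2, hx.2⟩) (key θ ⟨hpos.le, hθ.2⟩)
      refine ⟨hD.differentiableWithinAt, ?_⟩
      rw [hD.derivWithin huniq]
      refine aux_final hM (h1 r hr _) (h2 r hr _ hθ) (h1 r hr _) (by simp)
        (h3 r hr θ hθ _ hgθ) ?_
      refine (hR r hr θ ⟨hpos.le, hθ.2⟩).trans ?_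
      exact mul_le_of_le_one_right hP (by linarith)
end
end

section
/- There exists a constant C > 0, depending only on h, such that for every δ ∈ (−1,1), every r ∈ (0,1/2) with r ≠ r₀, and every θ ∈ [−1,0)∪(0,1], the partial derivative of g_r(θ) with respect to r exists and satisfies |∂g_r(θ)/∂r| ≤ C·|δ|. -/
open MeasureTheory Set Filter

noncomputable section

/-- Derivative of an implicitly defined function. -/
lemma aux_implicit (Q : ℝ × ℝ → ℝ) (L : ℝ × ℝ →L[ℝ] ℝ) (r : ℝ) (y : ℝ → ℝ)
    (hQ : HasFDerivAt Q L (r, y r)) (hb : L (0, 1) ≠ 0)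
    (h0 : ∀ᶠ s in nhds r, Q (s, y s) = 0)
    (h1 : ∀ᶠ s in nhds r, |y s - y r| ≤ |Q (s, y r)|) :
    HasDerivAt y (-L (1, 0) / L (0, 1)) r := by
  have hQr : Q (r, y r) = 0 := h0.self_of_nhds
  have hpart : HasDerivAt (fun s => Q (s, y r)) (L (1, 0)) r := by
    have : HasDerivAt (fun s : ℝ => (s, y r)) ((1 : ℝ), (0 : ℝ)) r :=
      (hasDerivAt_id r).prodMk (hasDerivAt_const r (y r))
    exact hQ.comp_hasDerivAt r this
  have hO : (fun s => y s - y r) =O[nhds r] (fun s => s - r) := by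
    have e1 : (fun s => y s - y r) =O[nhds r] (fun s => Q (s, y r)) :=
      Asymptotics.IsBigO.of_bound 1 (by
        filter_upwards [h1] with s hs
        simpa using hs)
    refine e1.trans ?_
    have := hpart.isBigO_sub
    simpa [hQr] using this
  have hcont : Tendsto y (nhds r) (nhds (y r)) := by
    have : Tendsto (fun s => y s - y r) (nhds r) (nhds 0) := by
      refine hO.trans_tendsto ?_
      have : Tendsto (fun s : ℝ => s - r) (nhds r) (nhds (r - r)) :=
        (continuous_id.sub continuous_const).tendsto r
      simpa using this
    have h2 := this.add_const (y r)
    simpa using h2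
  have hpair : Tendsto (fun s => (s, y s)) (nhds r) (nhds (r, y r)) :=
    tendsto_id.prodMk_nhds hcont
  have hlo := hQ.isLittleO.comp_tendsto hpair
  have hlo2 : (fun s => L (s - r, y s - y r)) =o[nhds r] (fun s => s - r) := by
    have e2 : ((fun x : ℝ × ℝ => x - (r, y r)) ∘ fun s => (s, y s)) =O[nhds r]
        (fun s => s - r) := by
      have : (fun s => (s - r, y s - y r)) =O[nhds r] (fun s => s - r) :=
        (Asymptotics.isBigO_refl _ _).prod_left hO
      exact this
    have := hlo.trans_isBigO e2
    refine (this.neg_left).congr' ?_ EventuallyEq.rfl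
    filter_upwards [h0] with s hs
    simp [hs, hQr]
    rw [← map_sub, Prod.mk_sub_mk]
  rw [hasDerivAt_iff_isLittleO]
  have hL : ∀ a b : ℝ, L (a, b) = a * L (1, 0) + b * L (0, 1) := by
    intro a b
    have : ((a, b) : ℝ × ℝ) = a • ((1 : ℝ), (0 : ℝ)) + b • ((0 : ℝ), (1 : ℝ)) := by
      simp
    rw [this, map_add, map_smul, map_smul]; simp
  refine (hlo2.const_mul_left (L (0, 1))⁻¹).congr_left ?_
  intro s
  rw [hL (s - r) (y s - y r)]
  simp only [smul_eq_mul]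
  field_simp
  ring

/-- The primitive in the angular variable. -/
def PP (k T x : ℝ) : ℝ := x + k * (x - Real.sin (x * T) / T)

lemma PP_int (k T a b : ℝ) (hT : T ≠ 0) :
    ∫ θ in a..b, (1 + k - k * Real.cos (θ * T)) = PP k T b - PP k T a := by
  apply intervalIntegral.integral_eq_sub_of_hasDerivAt
  · intro x _
    have h1 : HasDerivAt (fun x : ℝ => x * T) T x := by
      simpa using (hasDerivAt_id x).mul_const T
    have := (hasDerivAt_id x).add
      (((hasDerivAt_id x).sub ((h1.sin).div_const T)).const_mul k)
    unfold PP
    refine HasDerivAt.congr_deriv this ?_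
    field_simp
    ring
  · apply Continuous.intervalIntegrable
    fun_prop

lemma PP_expand (k T a b : ℝ) (hk : 0 ≤ k) (hT : 0 < T) :
    |b - a| ≤ |PP k T b - PP k T a| := by
  wlog hab : a ≤ b generalizing a b
  · have := this b a (by linarith)
    rwa [abs_sub_comm, abs_sub_comm (PP k T b)]
  have h1 : Real.sin (b * T) - Real.sin (a * T) ≤ (b - a) * T := by
    have := Real.abs_sin_sub_sin_le (b * T) (a * T)
    have h2 := (le_abs_self _).trans this
    rwa [← sub_mul, abs_of_nonneg (by nlinarith)] at h2
  have h3 : (Real.sin (b * T) - Real.sin (a * T)) / T ≤ b - a := by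
    rw [div_le_iff₀ hT]; exact h1
  have h4 : b - a ≤ PP k T b - PP k T a := by
    unfold PP
    have : 0 ≤ k * (b - a - (Real.sin (b * T) - Real.sin (a * T)) / T) :=
      mul_nonneg hk (by linarith)
    have e : b + k * (b - Real.sin (b * T) / T) - (a + k * (a - Real.sin (a * T) / T))
      = (b - a) + k * (b - a - (Real.sin (b * T) - Real.sin (a * T)) / T) := by ring
    linarith
  rw [abs_of_nonneg (by linarith)]
  exact h4.trans (le_abs_self _)

lemma one_sub_cos_bound (x T : ℝ) (hx : |x| ≤ 1) : |1 - Real.cos (x * T)| ≤ T ^ 2 := by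
  rw [abs_of_nonneg (by linarith [Real.cos_le_one (x * T)])]
  have := Real.one_sub_sq_div_two_le_cos (x := x * T)
  have h2 : x ^ 2 ≤ 1 := by rw [← sq_abs]; nlinarith [abs_nonneg x]
  have h3 : (x * T) ^ 2 ≤ T ^ 2 := by
    rw [mul_pow]; nlinarith [sq_nonneg T]
  nlinarith [sq_nonneg T]

lemma PP_lip (k T M a b : ℝ) (hT : T ≠ 0) (hM : |k * T ^ 2| ≤ M)
    (ha : a ∈ Icc (-1 : ℝ) 1) (hb : b ∈ Icc (-1 : ℝ) 1) :
    |PP k T b - PP k T a| ≤ (1 + M) * |b - a| := by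
  have key := (convex_Icc (-1 : ℝ) 1).norm_image_sub_le_of_norm_hasDerivWithin_le
    (f := PP k T) (f' := fun x => 1 + k * (1 - Real.cos (x * T))) (C := 1 + M) ?_ ?_ ha hb
  · simpa using key
  · intro x _
    have h1 : HasDerivAt (fun x : ℝ => x * T) T x := by
      simpa using (hasDerivAt_id x).mul_const T
    have := (hasDerivAt_id x).add
      (((hasDerivAt_id x).sub ((h1.sin).div_const T)).const_mul k)
    unfold PP
    refine HasDerivAt.hasDerivWithinAt ?_
    refine HasDerivAt.congr_deriv this ?_
    field_simp
  · intro x hx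
    have h1 := one_sub_cos_bound x T (abs_le.2 hx)
    have h2 : |k * (1 - Real.cos (x * T))| ≤ M := by
      refine le_trans ?_ hM
      rw [abs_mul, abs_mul, abs_of_nonneg (sq_nonneg T)]
      exact mul_le_mul_of_nonneg_left h1 (abs_nonneg k)
    calc ‖1 + k * (1 - Real.cos (x * T))‖ ≤ ‖(1 : ℝ)‖ + ‖k * (1 - Real.cos (x * T))‖ :=
          norm_add_le _ _
      _ ≤ 1 + M := by simpa using h2

/-- The derivative of the primitive in the radial variable. -/
def PS (k k' T T' x : ℝ) : ℝ :=
  k' * (x - Real.sin (x * T) / T)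
    - k * ((x * T' * Real.cos (x * T) * T - Real.sin (x * T) * T') / T ^ 2)

lemma PS_lip (k k' T T' M a b : ℝ) (hT : T ≠ 0) (hM : |k' * T ^ 2| ≤ M)
    (hM2 : |k * T * T'| ≤ M)
    (ha : a ∈ Icc (-1 : ℝ) 1) (hb : b ∈ Icc (-1 : ℝ) 1) :
    |PS k k' T T' b - PS k k' T T' a| ≤ (2 * M) * |b - a| := by
  have key := (convex_Icc (-1 : ℝ) 1).norm_image_sub_le_of_norm_hasDerivWithin_le
    (f := PS k k' T T')
    (f' := fun x => k' * (1 - Real.cos (x * T)) + k * T' * (x * Real.sin (x * T)))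
    (C := 2 * M) ?_ ?_ ha hb
  · simpa using key
  · intro x _
    have h1 : HasDerivAt (fun x : ℝ => x * T) T x := by
      simpa using (hasDerivAt_id x).mul_const T
    have h2 : HasDerivAt (fun x : ℝ => x * T') T' x := by
      simpa using (hasDerivAt_id x).mul_const T'
    have := (((hasDerivAt_id x).sub ((h1.sin).div_const T)).const_mul k').sub
      (((((h2.mul h1.cos).mul_const T).sub (h1.sin.mul_const T')).div_const (T ^ 2)).const_mul k)
    unfold PS
    refine HasDerivAt.hasDerivWithinAt ?_
    refine HasDerivAt.congr_deriv this ?_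
    field_simp
    ring
  · intro x hx
    have hx1 := abs_le.2 hx
    have h1 := one_sub_cos_bound x T hx1
    have h2 : |k' * (1 - Real.cos (x * T))| ≤ M := by
      refine le_trans ?_ hM
      rw [abs_mul, abs_mul, abs_of_nonneg (sq_nonneg T)]
      exact mul_le_mul_of_nonneg_left h1 (abs_nonneg k')
    have h3 : |x * Real.sin (x * T)| ≤ |T| := by
      have : |Real.sin (x * T)| ≤ |x * T| := Real.abs_sin_le_abs
      rw [abs_mul] at *
      have h5 : |x| * |T| ≤ |T| := by nlinarith [abs_nonneg T]
      calc |x| * |Real.sin (x * T)| ≤ 1 * |Real.sin (x * T)| :=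
            mul_le_mul_of_nonneg_right hx1 (abs_nonneg _)
        _ ≤ |T| := by linarith
    have h4 : |k * T' * (x * Real.sin (x * T))| ≤ M := by
      refine le_trans ?_ hM2
      rw [abs_mul, show k * T * T' = k * T' * T by ring, abs_mul (k * T') T]
      exact mul_le_mul_of_nonneg_left h3 (abs_nonneg _)
    have := (norm_add_le (k' * (1 - Real.cos (x * T))) (k * T' * (x * Real.sin (x * T))))
    simp only [Real.norm_eq_abs] at *
    linarith

/-- The main step, for both halves of the interval at once. -/
lemma aux_main (k Θ y : ℝ → ℝ) (r k' T' M e κ ℓ : ℝ) (hM0 : 0 ≤ M)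
    (hk' : HasDerivAt k k' r) (hT' : HasDerivAt Θ T' r)
    (hk : ∀ᶠ s in nhds r, 0 ≤ k s) (hT : ∀ᶠ s in nhds r, 0 < Θ s)
    (hM1 : |k r * Θ r ^ 2| ≤ M) (hM2 : |k' * Θ r ^ 2| ≤ M) (hM3 : |k r * Θ r * T'| ≤ M)
    (he : e ∈ Icc (-1 : ℝ) 1) (hl : ℓ ∈ Icc (-1 : ℝ) 1) (hy : y r ∈ Icc (-1 : ℝ) 1)
    (hyeq : ∀ᶠ s in nhds r, PP (k s) (Θ s) (y s) - PP (k s) (Θ s) e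
      = (1 + κ) * (PP (k s) (Θ s) ℓ - PP (k s) (Θ s) e)) :
    DifferentiableAt ℝ y r ∧ |deriv y r| ≤ (4 * M * (1 + M) + 4 * M) * |κ| := by
  have hTr : 0 < Θ r := hT.self_of_nhds
  have hkr : 0 ≤ k r := hk.self_of_nhds
  have hTne := hTr.ne'
  have hP : ∀ x : ℝ, HasDerivAt (fun s => PP (k s) (Θ s) x) (PS (k r) k' (Θ r) T' x) r := by
    intro x
    have h1 : HasDerivAt (fun s => x * Θ s) (x * T') r := hT'.const_mul x
    have := (hk'.mul ((h1.sin.div hT' hTne).const_sub x)).const_add x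
    unfold PP PS
    refine HasDerivAt.congr_deriv this ?_
    simp only [Pi.div_apply]
    ring
  have hP2 : HasFDerivAt (fun p : ℝ × ℝ => PP (k p.1) (Θ p.1) p.2)
      ((PS (k r) k' (Θ r) T' (y r)) • ContinuousLinearMap.fst ℝ ℝ ℝ
        + (1 + k r * (1 - Real.cos (y r * Θ r))) • ContinuousLinearMap.snd ℝ ℝ ℝ) (r, y r) := by
    have f1 : HasFDerivAt (fun p : ℝ × ℝ => k p.1) (k' • ContinuousLinearMap.fst ℝ ℝ ℝ) (r, y r) :=
      HasDerivAt.comp_hasFDerivAt (r, y r) (h₂ := k) (f := Prod.fst) hk' hasFDerivAt_fst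
    have f2 : HasFDerivAt (fun p : ℝ × ℝ => Θ p.1) (T' • ContinuousLinearMap.fst ℝ ℝ ℝ) (r, y r) :=
      HasDerivAt.comp_hasFDerivAt (r, y r) (h₂ := Θ) (f := Prod.fst) hT' hasFDerivAt_fst
    have f3 : HasFDerivAt (fun p : ℝ × ℝ => p.2) (ContinuousLinearMap.snd ℝ ℝ ℝ) (r, y r) :=
      hasFDerivAt_snd
    have f4 := (f3.mul f2).sin
    have f5 : HasFDerivAt (fun p : ℝ × ℝ => (Θ p.1)⁻¹)
        ((-T' / Θ r ^ 2) • ContinuousLinearMap.fst ℝ ℝ ℝ) (r, y r) :=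
      HasDerivAt.comp_hasFDerivAt (r, y r) (h₂ := fun s => (Θ s)⁻¹) (f := Prod.fst)
        (hT'.fun_inv hTne) hasFDerivAt_fst
    have f6 := f3.add (f1.mul (f3.sub (f4.mul f5)))
    unfold PP PS
    simp only [div_eq_mul_inv]
    refine HasFDerivAt.congr_fderiv f6 ?_
    ext
    · simp
      field_simp
      ring
    · simp
      left
      field_simp
  have hQ := hP2.sub (HasDerivAt.comp_hasFDerivAt (r, y r)
    (h₂ := fun s => PP (k s) (Θ s) e + (1 + κ) * (PP (k s) (Θ s) ℓ - PP (k s) (Θ s) e))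
    (f := Prod.fst) ((hP e).add (((hP ℓ).sub (hP e)).const_mul (1 + κ))) hasFDerivAt_fst)
  have hw : 1 ≤ 1 + k r * (1 - Real.cos (y r * Θ r)) := by
    have : 0 ≤ k r * (1 - Real.cos (y r * Θ r)) :=
      mul_nonneg hkr (by linarith [Real.cos_le_one (y r * Θ r)])
    linarith
  have hder := aux_implicit _ _ r y hQ (by simp; linarith)
    (by
      filter_upwards [hyeq] with s hs
      simp
      linarith)
    (by
      filter_upwards [hyeq, hk, hT] with s hs hks hTs
      refine (PP_expand (k s) (Θ s) (y r) (y s) hks hTs).trans ?_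
      rw [abs_sub_comm]
      refine le_of_eq ?_
      congr 1
      simp
      linarith)
  refine ⟨hder.differentiableAt, ?_⟩
  rw [hder.deriv]
  have hyr := hyeq.self_of_nhds
  have b1 : |ℓ - e| ≤ 2 := abs_le.2 ⟨by linarith [he.1, he.2, hl.1, hl.2], by
    linarith [he.1, he.2, hl.1, hl.2]⟩
  have b2 : |PP (k r) (Θ r) ℓ - PP (k r) (Θ r) e| ≤ (1 + M) * 2 :=
    (PP_lip (k r) (Θ r) M e ℓ hTne hM1 he hl).trans
      (mul_le_mul_of_nonneg_left b1 (by linarith))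
  have b3 : |y r - ℓ| ≤ |κ| * ((1 + M) * 2) := by
    refine (PP_expand (k r) (Θ r) ℓ (y r) hkr hTr).trans ?_
    rw [show PP (k r) (Θ r) (y r) - PP (k r) (Θ r) ℓ
      = κ * (PP (k r) (Θ r) ℓ - PP (k r) (Θ r) e) by linarith, abs_mul]
    exact mul_le_mul_of_nonneg_left b2 (abs_nonneg κ)
  have b4 := PS_lip (k r) k' (Θ r) T' M ℓ (y r) hTne hM2 hM3 hl hy
  have b5 := PS_lip (k r) k' (Θ r) T' M e ℓ hTne hM2 hM3 he hl
  have b6 : 2 * M * |y r - ℓ| ≤ 2 * M * (|κ| * ((1 + M) * 2)) :=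
    mul_le_mul_of_nonneg_left b3 (by linarith)
  have b7 : |κ| * |PS (k r) k' (Θ r) T' ℓ - PS (k r) k' (Θ r) T' e| ≤ |κ| * (2 * M * 2) :=
    mul_le_mul_of_nonneg_left (b5.trans (mul_le_mul_of_nonneg_left b1 (by linarith)))
      (abs_nonneg κ)
  rw [abs_div]
  refine div_le_of_le_mul₀ (abs_nonneg _) (by positivity) ?_
  have hone : ∀ A B : ℝ, 0 ≤ A → 1 ≤ B → A ≤ A * B := fun A B hA hB => by nlinarith
  refine le_trans ?_ (hone _ _ (by positivity) ?_)
  · have e1 : ∀ X Y Z : ℝ, |X - (Y + (1 + κ) * (Z - Y))| ≤ |X - Z| + |κ| * |Z - Y| := by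
      intro X Y Z
      rw [show X - (Y + (1 + κ) * (Z - Y)) = (X - Z) - κ * (Z - Y) by ring, ← abs_mul]
      exact abs_sub _ _
    have := e1 (PS (k r) k' (Θ r) T' (y r)) (PS (k r) k' (Θ r) T' e) (PS (k r) k' (Θ r) T' ℓ)
    rw [abs_neg]
    refine le_trans (le_of_eq ?_) (this.trans ?_)
    · simp
    · nlinarith
  · refine le_trans hw (le_trans (le_abs_self _) (le_of_eq ?_))
    simp

/-- Regularity facts for `h` extracted from `GoodH`. -/
lemma goodH_reg (h : ℝ → ℝ) (hh : GoodH h) :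
    ContDiffOn ℝ 3 h (Ioo (0 : ℝ) (1/2)) ∧ ContDiffOn ℝ 2 (deriv h) (Ioo (0 : ℝ) (1/2)) ∧
    ContDiffOn ℝ 1 (deriv (deriv h)) (Ioo (0 : ℝ) (1/2)) ∧
    (∀ r ∈ Ioo (0 : ℝ) (1/2), 0 ≤ deriv h r) ∧
    (∀ r ∈ Ioo (0 : ℝ) (1/10), deriv h r = 0) ∧
    (∀ r ∈ Ioo (0 : ℝ) (1/10), deriv (deriv h) r = 0) := by
  obtain ⟨-, hmono, hzero, -, hC, -⟩ := hh
  have hC3 : ContDiffOn ℝ 3 h (Ioo (0 : ℝ) (1/2)) := hC.mono Ioo_subset_Ico_self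
  have hC2 : ContDiffOn ℝ 2 (deriv h) (Ioo (0 : ℝ) (1/2)) :=
    hC3.deriv_of_isOpen isOpen_Ioo (by norm_num)
  have hC1 : ContDiffOn ℝ 1 (deriv (deriv h)) (Ioo (0 : ℝ) (1/2)) :=
    hC2.deriv_of_isOpen isOpen_Ioo (by norm_num)
  have hz1 : ∀ r ∈ Ioo (0 : ℝ) (1/10), deriv h r = 0 := by
    intro r hr
    have : h =ᶠ[nhds r] fun _ => (0 : ℝ) := by
      filter_upwards [isOpen_Ioo.mem_nhds hr] with s hs
      exact hzero s (Ioo_subset_Icc_self hs)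
    rw [this.deriv_eq]; simp
  refine ⟨hC3, hC2, hC1, ?_, hz1, ?_⟩
  · intro r hr
    rw [← derivWithin_of_isOpen isOpen_Ioo hr]
    exact (hmono.mono Ioo_subset_Ico_self).derivWithin_nonneg
  · intro r hr
    have : deriv h =ᶠ[nhds r] fun _ => (0 : ℝ) := by
      filter_upwards [isOpen_Ioo.mem_nhds hr] with s hs
      exact hz1 s hs
    rw [this.deriv_eq]; simp

/-- Bound on the second derivative of `h`. -/
lemma goodH_second (h : ℝ → ℝ) (hh : GoodH h) (c : ℝ)
    (hc : ∀ r ∈ Ico (0:ℝ) (1/2), |deriv (deriv (deriv h)) r| ≤ c * (r + h r) ^ 2)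
    (r : ℝ) (hr : r ∈ Ioo (0 : ℝ) (1/2)) : |deriv (deriv h) r| ≤ |c| * (r + h r) ^ 2 := by
  obtain ⟨-, -, hC1, -, -, hz2⟩ := goodH_reg h hh
  obtain ⟨hpos, hmono, -⟩ := hh
  by_cases hr1 : r < 1/10
  · rw [hz2 r ⟨hr.1, hr1⟩]; simp; positivity
  have key := (convex_Icc (1/20 : ℝ) r).norm_image_sub_le_of_norm_deriv_le
    (f := deriv (deriv h)) (C := |c| * (r + h r) ^ 2) (x := 1/20) (y := r) ?_ ?_
    ⟨le_rfl, by linarith⟩ ⟨by linarith, le_rfl⟩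
  · rw [hz2 (1/20) ⟨by norm_num, by norm_num⟩] at key
    simp only [sub_zero, Real.norm_eq_abs] at key
    refine key.trans (mul_le_of_le_one_right (by positivity) ?_)
    rw [abs_le]; constructor <;> linarith [hr.1, hr.2]
  · intro x hx
    have hx' : x ∈ Ioo (0 : ℝ) (1/2) := ⟨by linarith [hx.1], by linarith [hx.2, hr.2]⟩
    exact (hC1.contDiffAt (isOpen_Ioo.mem_nhds hx')).differentiableAt (by norm_num)
  · intro x hx
    have hx' : x ∈ Ico (0 : ℝ) (1/2) := ⟨by linarith [hx.1], by linarith [hx.2, hr.2]⟩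
    rw [Real.norm_eq_abs]
    refine (hc x hx').trans ?_
    have h1 : h x ≤ h r := hmono hx' ⟨hr.1.le, hr.2⟩ hx.2
    have h2 := hpos x hx'
    have h3 : (x + h x) ^ 2 ≤ (r + h r) ^ 2 :=
      pow_le_pow_left₀ (by linarith [hx'.1]) (by linarith [hx.2]) 2
    exact mul_le_mul (le_abs_self c) h3 (sq_nonneg _) (abs_nonneg c)

/-- Purely numerical estimates in the region beyond `r₀`. -/
lemma aux_numeric (k k' T T' S c N : ℝ) (hc : 0 ≤ c) (hS : 1/2 ≤ S) (hT : 0 ≤ T)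
    (hTS : T * S ≤ 1) (hk2 : k ^ 2 ≤ c * S ^ 3) (hk' : |k'| ≤ c * S ^ 2)
    (hT' : |T'| * S ^ 2 ≤ (|k| + 1) * N) (hN : 0 ≤ N) :
    |k * T ^ 2| ≤ 2 * c + 1 ∧ |k' * T ^ 2| ≤ c ∧ |k * T * T'| ≤ (2 * c + 8) * N := by
  have hSp : 0 < S := by linarith
  have hTS2 : T ^ 2 * S ^ 2 ≤ 1 := by
    rw [← mul_pow]; exact pow_le_one₀ (by positivity) hTS
  have hkS : |k| ≤ (2 * c + 1) * S ^ 2 := by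
    refine abs_le_of_sq_le_sq ?_ (by positivity)
    refine hk2.trans ?_
    have h1 : c * S ^ 3 ≤ 2 * c * S ^ 4 := by
      have : 0 ≤ c * S ^ 3 * (2 * S - 1) := mul_nonneg (by positivity) (by linarith)
      nlinarith
    have h2 : 2 * c * S ^ 4 ≤ (2 * c + 1) ^ 2 * S ^ 4 :=
      mul_le_mul_of_nonneg_right (by nlinarith) (by positivity)
    nlinarith
  refine ⟨?_, ?_, ?_⟩
  · rw [abs_mul, abs_of_nonneg (sq_nonneg T)]
    calc |k| * T ^ 2 ≤ (2 * c + 1) * S ^ 2 * T ^ 2 :=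
          mul_le_mul_of_nonneg_right hkS (sq_nonneg T)
      _ = (2 * c + 1) * (T ^ 2 * S ^ 2) := by ring
      _ ≤ 2 * c + 1 := mul_le_of_le_one_right (by positivity) hTS2
  · rw [abs_mul, abs_of_nonneg (sq_nonneg T)]
    calc |k'| * T ^ 2 ≤ c * S ^ 2 * T ^ 2 :=
          mul_le_mul_of_nonneg_right hk' (sq_nonneg T)
      _ = c * (T ^ 2 * S ^ 2) := by ring
      _ ≤ c := mul_le_of_le_one_right (by positivity) hTS2
  · rw [abs_mul, abs_mul, abs_of_nonneg hT]
    have hS3 : 0 < S ^ 3 := by positivity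
    refine le_of_mul_le_mul_right ?_ hS3
    have h8 : 1 ≤ 8 * S ^ 3 := by
      have : (1/2 : ℝ) ^ 3 ≤ S ^ 3 := pow_le_pow_left₀ (by norm_num) hS 3
      linarith
    calc |k| * T * |T'| * S ^ 3 = |k| * ((T * S) * (|T'| * S ^ 2)) := by ring
      _ ≤ |k| * (1 * ((|k| + 1) * N)) := by
          apply mul_le_mul_of_nonneg_left _ (abs_nonneg k)
          exact mul_le_mul hTS hT' (by positivity) (by norm_num)
      _ = (|k| * (|k| + 1)) * N := by ring
      _ ≤ (2 * k ^ 2 + 1) * N := by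
          apply mul_le_mul_of_nonneg_right _ hN
          rw [← sq_abs k]
          nlinarith [sq_nonneg (|k| - 1), abs_nonneg k]
      _ ≤ ((2 * c + 8) * S ^ 3) * N := by
          apply mul_le_mul_of_nonneg_right _ hN
          nlinarith
      _ = (2 * c + 8) * N * S ^ 3 := by ring

/-- Positivity of the angle. -/
lemma theta_pos (h : ℝ → ℝ) (hh : GoodH h) (r₀ : ℝ) (Θ : ℝ → ℝ) (hΘ : GoodTheta h r₀ Θ)
    (r : ℝ) (hr : r ∈ Ioo (0 : ℝ) (1/2)) : 0 < Θ r := by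
  have hp := hh.1 r ⟨hr.1.le, hr.2⟩
  rcases le_or_gt r r₀ with h1 | h1
  · rw [hΘ.1 r hr.1 h1, Real.arccos_pos, div_lt_one (by linarith [hr.1])]
    linarith [hr.1]
  · rw [hΘ.2 r h1 hr.2, Real.arcsin_pos]
    have := hr.1
    positivity

/-- The uniform bounds on the ingredients. -/
lemma aux_bounds (h : ℝ → ℝ) (hh : GoodH h)
    (r₀ : ℝ) (hr₀ : r₀ ∈ Set.Ioo (0:ℝ) (1/2)) (hr₀eq : 2 * r₀ * h r₀ + r₀ ^ 2 = 1/4)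
    (Θ : ℝ → ℝ) (hΘ : GoodTheta h r₀ Θ) :
    ∃ M : ℝ, 0 ≤ M ∧ ∀ r ∈ Ioo (0 : ℝ) (1/2), r ≠ r₀ →
      ∃ k' T' : ℝ, HasDerivAt (deriv h) k' r ∧ HasDerivAt Θ T' r ∧
        |deriv h r * Θ r ^ 2| ≤ M ∧ |k' * Θ r ^ 2| ≤ M ∧ |deriv h r * Θ r * T'| ≤ M := by
  obtain ⟨hC3, hC2, hC1, hk0, hz1, hz2⟩ := goodH_reg h hh
  have hh' := hh
  obtain ⟨hpos, hmono, hzero, -, -, c, hc⟩ := hh'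
  have hsec := goodH_second h hh c (fun r hr => (hc r hr).2.2)
  have hd : ∀ r ∈ Ioo (0 : ℝ) (1/2), HasDerivAt h (deriv h r) r := fun r hr =>
    ((hC3.contDiffAt (isOpen_Ioo.mem_nhds hr)).differentiableAt (by norm_num)).hasDerivAt
  have hd2 : ∀ r ∈ Ioo (0 : ℝ) (1/2), HasDerivAt (deriv h) (deriv (deriv h) r) r := fun r hr =>
    ((hC2.contDiffAt (isOpen_Ioo.mem_nhds hr)).differentiableAt (by norm_num)).hasDerivAt
  -- region below `r₀`
  set u : ℝ → ℝ := fun s => h s / (h s + s) with hu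
  set u' : ℝ → ℝ := fun s => (deriv h s * (h s + s) - h s * (deriv h s + 1)) / (h s + s) ^ 2
    with hu'
  set A : ℝ → ℝ := fun s => -(1 / Real.sqrt (1 - u s ^ 2)) * u' s with hA
  have hsum : ∀ s ∈ Ioo (0 : ℝ) (1/2), 0 < h s + s := fun s hs => by
    linarith [hpos s ⟨hs.1.le, hs.2⟩, hs.1]
  have hu01 : ∀ s ∈ Ioo (0 : ℝ) (1/2), 0 ≤ u s ∧ u s < 1 := by
    intro s hs
    refine ⟨div_nonneg (hpos s ⟨hs.1.le, hs.2⟩) (hsum s hs).le, ?_⟩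
    rw [hu]
    simp only
    rw [div_lt_one (hsum s hs)]
    linarith [hs.1]
  have hA1 : ∀ s ∈ Ioo (0 : ℝ) (1/2), HasDerivAt (fun t => Real.arccos (u t)) (A s) s := by
    intro s hs
    have e1 : HasDerivAt u (u' s) s :=
      (hd s hs).div ((hd s hs).add (hasDerivAt_id s)) (hsum s hs).ne'
    have := hu01 s hs
    exact (Real.hasDerivAt_arccos (by linarith) (by linarith)).comp s e1
  have hsub : Icc (1/20) r₀ ⊆ Ioo (0 : ℝ) (1/2) := fun s hs =>
    ⟨by linarith [hs.1], by linarith [hs.2, hr₀.2]⟩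
  have ch : ContinuousOn h (Icc (1/20) r₀) := hC3.continuousOn.mono hsub
  have ck : ContinuousOn (deriv h) (Icc (1/20) r₀) := hC2.continuousOn.mono hsub
  have ck' : ContinuousOn (deriv (deriv h)) (Icc (1/20) r₀) := hC1.continuousOn.mono hsub
  have chs : ContinuousOn (fun s => h s + s) (Icc (1/20) r₀) := ch.add continuousOn_id
  have cu : ContinuousOn u (Icc (1/20) r₀) :=
    ch.div chs (fun s hs => (hsum s (hsub hs)).ne')
  have cu' : ContinuousOn u' (Icc (1/20) r₀) :=
    ((ck.mul chs).sub (ch.mul (ck.add continuousOn_const))).div (chs.pow 2)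
      (fun s hs => pow_ne_zero 2 (hsum s (hsub hs)).ne')
  have cA : ContinuousOn A (Icc (1/20) r₀) := by
    refine ContinuousOn.mul (ContinuousOn.neg (continuousOn_const.div ?_ ?_)) cu'
    · exact Real.continuous_sqrt.comp_continuousOn (continuousOn_const.sub (cu.pow 2))
    · intro s hs
      have := hu01 s (hsub hs)
      exact (Real.sqrt_pos.2 (by nlinarith)).ne'
  have cT : ContinuousOn (fun t => Real.arccos (u t)) (Icc (1/20) r₀) :=
    Real.continuous_arccos.comp_continuousOn cu
  obtain ⟨M1, hM1⟩ := isCompact_Icc.exists_bound_of_continuousOn (ck.mul (cT.pow 2))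
  obtain ⟨M2, hM2⟩ := isCompact_Icc.exists_bound_of_continuousOn (ck'.mul (cT.pow 2))
  obtain ⟨M3, hM3⟩ := isCompact_Icc.exists_bound_of_continuousOn ((ck.mul cT).mul cA)
  -- region above `r₀`
  set m := h r₀ + r₀ with hm
  have hm2 : 1/2 < m := by
    have h0 := hpos r₀ ⟨hr₀.1.le, hr₀.2⟩
    have h1 : h r₀ ≠ 0 := by
      intro h2
      rw [h2] at hr₀eq
      nlinarith [hr₀.1, hr₀.2]
    have h2 : 0 < h r₀ := lt_of_le_of_ne h0 (Ne.symm h1)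
    nlinarith [hr₀.1]
  set N := 1 / Real.sqrt (1 - (1 / (2 * m)) ^ 2) with hN
  have hv0 : 1 / (2 * m) < 1 := by rw [div_lt_one (by linarith)]; linarith
  have hv0p : 0 < 1 / (2 * m) := by positivity
  have hN0 : 0 ≤ N := by positivity
  refine ⟨|M1| + |M2| + |M3| + (2 * |c| + 1) + |c| + (2 * |c| + 8) * N, by positivity, ?_⟩
  have p1 := abs_nonneg M1
  have p2 := abs_nonneg M2
  have p3 := abs_nonneg M3
  have p4 := abs_nonneg c
  have p5 : 0 ≤ (2 * |c| + 8) * N := by positivity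
  intro r hr hne
  refine ⟨deriv (deriv h) r, ?_⟩
  rcases lt_or_gt_of_ne hne with hlt | hgt
  · refine ⟨A r, hd2 r hr, ?_, ?_⟩
    · refine (hA1 r hr).congr_of_eventuallyEq ?_
      filter_upwards [isOpen_Ioo.mem_nhds (⟨hr.1, hlt⟩ : r ∈ Ioo 0 r₀)] with s hs
      exact hΘ.1 s hs.1 hs.2.le
    · by_cases hr1 : r < 1/10
      · rw [hz1 r ⟨hr.1, hr1⟩, hz2 r ⟨hr.1, hr1⟩]
        simp only [zero_mul, abs_zero]
        refine ⟨?_, ?_, ?_⟩ <;> positivity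
      · have hmem : r ∈ Icc (1/20) r₀ := ⟨by linarith, hlt.le⟩
        have b1 := (hM1 r hmem).trans (le_abs_self M1)
        have b2 := (hM2 r hmem).trans (le_abs_self M2)
        have b3 := (hM3 r hmem).trans (le_abs_self M3)
        rw [hΘ.1 r hr.1 hlt.le]
        simp only [Real.norm_eq_abs, Pi.mul_apply, Pi.pow_apply] at b1 b2 b3
        exact ⟨b1.trans (by linarith), b2.trans (by linarith), b3.trans (by linarith)⟩
  · have hS : m ≤ h r + r := by
      have := hmono ⟨hr₀.1.le, hr₀.2⟩ ⟨hr.1.le, hr.2⟩ hgt.le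
      linarith
    set S := h r + r with hSdef
    have hSp : 0 < S := by linarith
    have hv : 1 / (2 * S) ≤ 1 / (2 * m) :=
      one_div_le_one_div_of_le (by linarith) (by linarith)
    have hvp : 0 < 1 / (2 * S) := by positivity
    set T' := (1 / Real.sqrt (1 - (1 / (2 * S)) ^ 2)) *
      (-(2 * (deriv h r + 1)) / (2 * S) ^ 2) with hT'
    have hTd : HasDerivAt Θ T' r := by
      have e1 : HasDerivAt (fun s => 1 / (2 * (h s + s)))
          (-(2 * (deriv h r + 1)) / (2 * S) ^ 2) r := by
        simp only [one_div]
        exact (((hd r hr).add (hasDerivAt_id r)).const_mul 2).fun_inv (by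
          simp only [Pi.add_apply, id]; linarith)
      have e2 := (Real.hasDerivAt_arcsin (x := 1 / (2 * S)) (by linarith) (by linarith)).comp r e1
      refine e2.congr_of_eventuallyEq ?_
      filter_upwards [isOpen_Ioo.mem_nhds (⟨hgt, hr.2⟩ : r ∈ Ioo r₀ (1/2))] with s hs
      exact hΘ.2 s hs.1 hs.2
    have hTp := theta_pos h hh r₀ Θ hΘ r hr
    have hTS : Θ r * S ≤ 1 := by
      have e1 : Θ r ≤ Real.pi / 2 := by
        rw [hΘ.2 r hgt hr.2]; exact Real.arcsin_le_pi_div_two _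
      have e2 := Real.mul_le_sin hTp.le e1
      rw [hΘ.2 r hgt hr.2, Real.sin_arcsin (by linarith) (by linarith), ← hΘ.2 r hgt hr.2] at e2
      have e3 : (1/2 : ℝ) ≤ 2 / Real.pi := by
        rw [div_le_div_iff₀ (by norm_num) Real.pi_pos]
        linarith [Real.pi_le_four]
      have e4 : 1/2 * Θ r ≤ 1 / (2 * S) :=
        (mul_le_mul_of_nonneg_right e3 hTp.le).trans e2
      rw [le_div_iff₀ (by linarith)] at e4
      linarith
    have hT'S : |T'| * S ^ 2 ≤ (|deriv h r| + 1) * N := by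
      have hkp := hk0 r hr
      have e1 : 1 / Real.sqrt (1 - (1 / (2 * S)) ^ 2) ≤ N := by
        apply one_div_le_one_div_of_le
        · apply Real.sqrt_pos.2; nlinarith
        · apply Real.sqrt_le_sqrt
          have := pow_le_pow_left₀ hvp.le hv 2
          linarith
      rw [hT', abs_mul, abs_of_nonneg (by positivity), abs_div, abs_neg,
        abs_of_nonneg (by positivity), abs_of_nonneg (by positivity), abs_of_nonneg hkp]
      have e2 : 2 * (deriv h r + 1) / (2 * S) ^ 2 * S ^ 2 = (deriv h r + 1) / 2 := by
        field_simp
      rw [mul_assoc, e2]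
      calc 1 / Real.sqrt (1 - (1 / (2 * S)) ^ 2) * ((deriv h r + 1) / 2)
          ≤ N * ((deriv h r + 1) / 2) := mul_le_mul_of_nonneg_right e1 (by positivity)
        _ ≤ (deriv h r + 1) * N := by nlinarith [mul_nonneg hN0 (by linarith : 0 ≤ deriv h r + 1)]
    have hk2 : deriv h r ^ 2 ≤ |c| * S ^ 3 := by
      refine (hc r ⟨hr.1.le, hr.2⟩).1.trans ?_
      rw [add_comm r (h r)]
      exact mul_le_mul_of_nonneg_right (le_abs_self c) (by positivity)
    have hk' : |deriv (deriv h) r| ≤ |c| * S ^ 2 := by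
      have := hsec r hr
      rwa [add_comm r (h r)] at this
    obtain ⟨b1, b2, b3⟩ := aux_numeric (deriv h r) (deriv (deriv h) r) (Θ r) T' S |c| N p4
      (by linarith) hTp.le hTS hk2 hk' hT'S hN0
    exact ⟨T', hd2 r hr, hTd, b1.trans (by linarith), b2.trans (by linarith),
      b3.trans (by linarith)⟩

theorem stmt_8 (h : ℝ → ℝ) (hh : GoodH h)
    (r₀ : ℝ) (hr₀ : r₀ ∈ Set.Ioo (0:ℝ) (1/2)) (hr₀eq : 2 * r₀ * h r₀ + r₀ ^ 2 = 1/4)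
    (Θ : ℝ → ℝ) (hΘ : GoodTheta h r₀ Θ) :
    ∃ C : ℝ, 0 < C ∧
      ∀ δ ∈ Set.Ioo (-1:ℝ) 1, ∀ g : ℝ → ℝ → ℝ, IsGFamily h Θ δ g →
        ∀ r ∈ Set.Ioo (0:ℝ) (1/2), r ≠ r₀ → ∀ θ ∈ Set.Icc (-1:ℝ) 1, θ ≠ 0 →
          DifferentiableAt ℝ (fun s => g s θ) r ∧
          |deriv (fun s => g s θ) r| ≤ C * |δ| := by
  obtain ⟨M, hM0, hM⟩ := aux_bounds h hh r₀ hr₀ hr₀eq Θ hΘ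
  obtain ⟨-, -, -, hk0, -, -⟩ := goodH_reg h hh
  have hTpos := theta_pos h hh r₀ Θ hΘ
  refine ⟨4 * M * (1 + M) + 4 * M + 1, by positivity, ?_⟩
  intro δ hδ g hg r hr hne θ hθ hθ0
  obtain ⟨k', T', hk', hT', b1, b2, b3⟩ := hM r hr hne
  have hnh : ∀ᶠ s in nhds r, s ∈ Ioo (0 : ℝ) (1/2) := isOpen_Ioo.mem_nhds hr
  have hkev : ∀ᶠ s in nhds r, 0 ≤ deriv h s := hnh.mono hk0
  have hTev : ∀ᶠ s in nhds r, 0 < Θ s := hnh.mono hTpos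
  have hy : g r θ ∈ Icc (-1 : ℝ) 1 := (hg r hr).2.1.mapsTo hθ
  have hfinal : ∀ κ : ℝ, |κ| = |δ| → ∀ e ∈ Icc (-1 : ℝ) 1,
      (∀ s ∈ Ioo (0 : ℝ) (1/2), PP (deriv h s) (Θ s) (g s θ) - PP (deriv h s) (Θ s) e
        = (1 + κ) * (PP (deriv h s) (Θ s) θ - PP (deriv h s) (Θ s) e)) →
      DifferentiableAt ℝ (fun s => g s θ) r ∧
        |deriv (fun s => g s θ) r| ≤ (4 * M * (1 + M) + 4 * M + 1) * |δ| := by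
    intro κ hκ e he heq
    have := aux_main (deriv h) Θ (fun s => g s θ) r k' T' M e κ θ hM0 hk' hT' hkev hTev
      b1 b2 b3 he hθ hy (hnh.mono heq)
    refine ⟨this.1, this.2.trans ?_⟩
    rw [hκ]
    nlinarith [abs_nonneg δ]
  rcases le_total θ 0 with h0 | h0
  · refine hfinal δ rfl (-1) ⟨le_rfl, by norm_num⟩ ?_
    intro s hs
    have := (hg s hs).2.2.2.2.1 θ ⟨hθ.1, h0⟩
    simp only [wgt] at this
    rw [PP_int _ _ _ _ (hTpos s hs).ne', PP_int _ _ _ _ (hTpos s hs).ne'] at this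
    exact this.symm
  · refine hfinal (-δ) (abs_neg δ) 1 ⟨by norm_num, le_rfl⟩ ?_
    intro s hs
    have := (hg s hs).2.2.2.2.2 θ ⟨h0, hθ.2⟩
    simp only [wgt] at this
    rw [PP_int _ _ _ _ (hTpos s hs).ne', PP_int _ _ _ _ (hTpos s hs).ne'] at this
    linarith
end
end

section
/- Let w : [−1,1] → ℝ be continuous, strictly positive, and even. Then for each δ ∈ (−1,1) there exists a unique δ-rebalancing of w, i.e. a unique increasing bijection g : [−1,1] → [−1,1] with g(−1) = −1 and g(1) = 1 satisfying (1+δ)·∫_{−1}^{ℓ} w(θ)dθ = ∫_{−1}^{g(ℓ)} w(θ)dθ for all ℓ ∈ [−1,0] and (1−δ)·∫_{ℓ}^{1} w(θ)dθ = ∫_{g(ℓ)}^{1} w(θ)dθ for all ℓ ∈ [0,1]. -/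
open MeasureTheory Set

noncomputable section

/-- A `δ`-rebalancing of a weight `w` on `[−1,1]`: an increasing bijection of `[−1,1]`
fixing the endpoints that rescales the `w`-mass of initial segments of `[−1,0]` by `1+δ`
and of final segments of `[0,1]` by `1−δ`. -/
def IsRebalancing (w : ℝ → ℝ) (δ : ℝ) (g : ℝ → ℝ) : Prop :=
  StrictMonoOn g (Set.Icc (-1:ℝ) 1) ∧
  Set.BijOn g (Set.Icc (-1:ℝ) 1) (Set.Icc (-1:ℝ) 1) ∧
  g (-1) = -1 ∧ g 1 = 1 ∧
  (∀ ℓ ∈ Set.Icc (-1:ℝ) 0, (1 + δ) * ∫ θ in (-1:ℝ)..ℓ, w θ = ∫ θ in (-1:ℝ)..(g ℓ), w θ) ∧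
  (∀ ℓ ∈ Set.Icc (0:ℝ) 1, (1 - δ) * ∫ θ in ℓ..(1:ℝ), w θ = ∫ θ in (g ℓ)..(1:ℝ), w θ)

theorem stmt_9 (w : ℝ → ℝ) (hw_cont : ContinuousOn w (Set.Icc (-1:ℝ) 1))
    (hw_pos : ∀ θ ∈ Set.Icc (-1:ℝ) 1, 0 < w θ)
    (hw_even : ∀ θ ∈ Set.Icc (-1:ℝ) 1, w (-θ) = w θ)
    (δ : ℝ) (hδ : δ ∈ Set.Ioo (-1:ℝ) 1) :
    ∃ g : ℝ → ℝ, IsRebalancing w δ g ∧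
      ∀ g' : ℝ → ℝ, IsRebalancing w δ g' → Set.EqOn g g' (Set.Icc (-1:ℝ) 1) := by
  obtain ⟨hδ1, hδ2⟩ := hδ
  have hint : ∀ a ∈ Set.Icc (-1:ℝ) 1, ∀ b ∈ Set.Icc (-1:ℝ) 1,
      IntervalIntegrable w volume a b := fun a ha b hb =>
    (hw_cont.mono (Set.uIcc_subset_Icc ha hb)).intervalIntegrable
  have m1 : (-1:ℝ) ∈ Set.Icc (-1:ℝ) 1 := by norm_num
  have m0 : (0:ℝ) ∈ Set.Icc (-1:ℝ) 1 := by norm_num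
  have p1 : (1:ℝ) ∈ Set.Icc (-1:ℝ) 1 := by norm_num
  obtain ⟨F, hF⟩ : ∃ F : ℝ → ℝ, ∀ x, F x = ∫ θ in (-1:ℝ)..x, w θ := ⟨_, fun _ => rfl⟩
  have hsub : ∀ a ∈ Set.Icc (-1:ℝ) 1, ∀ b ∈ Set.Icc (-1:ℝ) 1,
      ∫ θ in a..b, w θ = F b - F a := by
    intro a ha b hb
    rw [hF, hF, intervalIntegral.integral_interval_sub_left (hint _ m1 _ hb) (hint _ m1 _ ha)]
  have hmono : StrictMonoOn F (Set.Icc (-1:ℝ) 1) := by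
    intro a ha b hb hab
    have h := intervalIntegral.intervalIntegral_pos_of_pos_on (hint a ha b hb)
      (fun x hx => hw_pos x ⟨ha.1.trans hx.1.le, hx.2.le.trans hb.2⟩) hab
    rw [hsub a ha b hb] at h
    linarith
  have hcont : ContinuousOn F (Set.Icc (-1:ℝ) 1) := by
    have h := intervalIntegral.continuousOn_primitive_interval (f := w) (μ := volume)
      (a := -1) (b := 1) (by
        rw [Set.uIcc_of_le (by norm_num)]
        exact hw_cont.integrableOn_Icc)
    rw [Set.uIcc_of_le (by norm_num)] at h
    exact h.congr (fun x _ => hF x)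
  have hFm : F (-1) = 0 := by rw [hF]; simp
  have hF0 : F 1 = 2 * F 0 := by
    have h1 : ∫ θ in (-1:ℝ)..0, w θ = ∫ θ in (0:ℝ)..1, w θ := by
      have h2 : ∫ θ in (-1:ℝ)..0, w θ = ∫ θ in (-1:ℝ)..0, w (-θ) := by
        apply intervalIntegral.integral_congr
        intro x hx
        rw [Set.uIcc_of_le (by norm_num)] at hx
        exact (hw_even x ⟨hx.1, by linarith [hx.2]⟩).symm
      rw [h2, intervalIntegral.integral_comp_neg]
      simp
    rw [hsub _ m0 _ p1, ← hF] at h1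
    linarith
  have hM : 0 < F 0 := by
    have := hmono m1 m0 (by norm_num); linarith
  have hsurj : ∀ u, 0 ≤ u → u ≤ F 1 → ∃ x ∈ Set.Icc (-1:ℝ) 1, F x = u := by
    intro u h0 h1
    exact intermediate_value_Icc (by norm_num) hcont ⟨by rw [hFm]; exact h0, h1⟩
  obtain ⟨S, hS1, hS2⟩ : ∃ S : ℝ → ℝ, (∀ u, u ≤ F 0 → S u = (1 + δ) * u) ∧
      (∀ u, F 0 ≤ u → S u = F 1 - (1 - δ) * (F 1 - u)) := by
    refine ⟨fun u => if u ≤ F 0 then (1 + δ) * u else F 1 - (1 - δ) * (F 1 - u), ?_, ?_⟩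
    · intro u hu
      simp [hu]
    · intro u hu
      rcases hu.eq_or_lt with h | h
      · subst h
        simp only [le_refl, if_true]
        rw [hF0]; ring
      · simp [not_le.mpr h]
  have hSmono : StrictMono S := by
    intro a b hab
    rcases le_total a (F 0) with ha | ha <;> rcases le_total b (F 0) with hb | hb
    · rw [hS1 a ha, hS1 b hb]; nlinarith
    · rw [hS1 a ha, hS2 b hb]
      rcases ha.eq_or_lt with h | h
      · rw [h, hF0]; nlinarith
      · nlinarith
    · linarith
    · rw [hS2 a ha, hS2 b hb]; nlinarith
  have hSz : S 0 = 0 := by rw [hS1 0 hM.le]; ring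
  have hSM : S (F 1) = F 1 := by rw [hS2 _ (by linarith)]; ring
  have hFr : ∀ x ∈ Set.Icc (-1:ℝ) 1, 0 ≤ F x ∧ F x ≤ F 1 := fun x hx =>
    ⟨hFm ▸ hmono.monotoneOn m1 hx hx.1, hmono.monotoneOn hx p1 hx.2⟩
  have hex : ∀ x, ∃ y, x ∈ Set.Icc (-1:ℝ) 1 → y ∈ Set.Icc (-1:ℝ) 1 ∧ F y = S (F x) := by
    intro x
    by_cases hx : x ∈ Set.Icc (-1:ℝ) 1
    · obtain ⟨y, hy, h⟩ := hsurj (S (F x)) (hSz ▸ hSmono.monotone (hFr x hx).1)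
        (by have := hSmono.monotone (hFr x hx).2; rwa [hSM] at this)
      exact ⟨y, fun _ => ⟨hy, h⟩⟩
    · exact ⟨0, fun h => absurd h hx⟩
  choose g hg using hex
  have hgm : StrictMonoOn g (Set.Icc (-1:ℝ) 1) := by
    intro a ha b hb hab
    rw [← hmono.lt_iff_lt (hg a ha).1 (hg b hb).1, (hg a ha).2, (hg b hb).2]
    exact hSmono (hmono ha hb hab)
  have hSsurj : ∀ v, 0 ≤ v → v ≤ F 1 → ∃ u, 0 ≤ u ∧ u ≤ F 1 ∧ S u = v := by
    intro v h0 h1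
    have hd1 : 0 < 1 + δ := by linarith
    have hd2 : 0 < 1 - δ := by linarith
    rcases le_total v ((1 + δ) * F 0) with h | h
    · have hu : v / (1 + δ) ≤ F 0 := by rw [div_le_iff₀ hd1]; linarith
      refine ⟨v / (1 + δ), by positivity, by linarith, ?_⟩
      rw [hS1 _ hu]; field_simp
    · have hu : (F 1 - v) / (1 - δ) ≤ F 0 := by
        rw [div_le_iff₀ hd2, hF0]; linarith
      have hu' : 0 ≤ (F 1 - v) / (1 - δ) := div_nonneg (by linarith) hd2.le
      refine ⟨F 1 - (F 1 - v) / (1 - δ), by linarith, by linarith, ?_⟩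
      rw [hS2 _ (by linarith)]; field_simp; ring
  refine ⟨g, ⟨hgm, ⟨fun x hx => (hg x hx).1, hgm.injOn, ?_⟩, ?_, ?_, ?_, ?_⟩, ?_⟩
  · intro y hy
    obtain ⟨u, hu0, hu1, hu⟩ := hSsurj (F y) (hFr y hy).1 (hFr y hy).2
    obtain ⟨x, hx, hxu⟩ := hsurj u hu0 hu1
    refine ⟨x, hx, hmono.injOn (hg x hx).1 hy ?_⟩
    rw [(hg x hx).2, hxu, hu]
  · exact hmono.injOn (hg _ m1).1 m1 (by rw [(hg _ m1).2, hFm, hSz])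
  · exact hmono.injOn (hg _ p1).1 p1 (by rw [(hg _ p1).2, hSM])
  · intro l hl
    have hl' : l ∈ Set.Icc (-1:ℝ) 1 := ⟨hl.1, by linarith [hl.2]⟩
    rw [← hF, ← hF, (hg l hl').2, hS1 _ (hmono.monotoneOn hl' m0 hl.2)]
  · intro l hl
    have hl' : l ∈ Set.Icc (-1:ℝ) 1 := ⟨by linarith [hl.1], hl.2⟩
    rw [hsub _ hl' _ p1, hsub _ (hg l hl').1 _ p1, (hg l hl').2,
      hS2 _ (hmono.monotoneOn m0 hl' hl.1)]
    ring
  · rintro g' ⟨-, hb, -, -, h1, h2⟩ l hl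
    have hl' := hb.mapsTo hl
    refine hmono.injOn (hg l hl).1 hl' ?_
    rw [(hg l hl).2]
    rcases le_total l 0 with h | h
    · have := h1 l ⟨hl.1, h⟩
      rw [← hF, ← hF] at this
      rw [hS1 _ (hmono.monotoneOn hl m0 h), this]
    · have := h2 l ⟨h, hl.2⟩
      rw [hsub _ hl _ p1, hsub _ hl' _ p1] at this
      rw [hS2 _ (hmono.monotoneOn m0 hl h), this]
      ring
end
end

section
/- Let w : [−1,1] → ℝ be continuous, strictly positive, and even, let δ ∈ (−1,1), and let g be a δ-rebalancing of w. Then for every ℓ ∈ [−1,0], |g(ℓ) − ℓ| ≤ |δ|·(ℓ+1)·(max w)/(min w), where max w and min w denote the maximum and minimum values of w on [−1,1]. -/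
open MeasureTheory Set

noncomputable section

theorem stmt_10 (w : ℝ → ℝ) (hw_cont : ContinuousOn w (Set.Icc (-1:ℝ) 1))
    (hw_pos : ∀ θ ∈ Set.Icc (-1:ℝ) 1, 0 < w θ)
    (hw_even : ∀ θ ∈ Set.Icc (-1:ℝ) 1, w (-θ) = w θ)
    (δ : ℝ) (hδ : δ ∈ Set.Ioo (-1:ℝ) 1)
    (g : ℝ → ℝ) (hg : IsRebalancing w δ g) :
    ∀ ℓ ∈ Set.Icc (-1:ℝ) 0,
      |g ℓ - ℓ| ≤ |δ| * (ℓ + 1) *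
        (sSup (w '' Set.Icc (-1:ℝ) 1) / sInf (w '' Set.Icc (-1:ℝ) 1)) := by
  intro ℓ hℓ
  obtain ⟨-, hbij, -, -, h1, -⟩ := hg
  have hℓ' : ℓ ∈ Set.Icc (-1:ℝ) 1 := ⟨hℓ.1, by linarith [hℓ.2]⟩
  have hgl : g ℓ ∈ Set.Icc (-1:ℝ) 1 := hbij.mapsTo hℓ'
  have hm1 : (-1:ℝ) ∈ Set.Icc (-1:ℝ) 1 := by norm_num
  have hcomp : IsCompact (w '' Set.Icc (-1:ℝ) 1) := isCompact_Icc.image_of_continuousOn hw_cont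
  have hne : (w '' Set.Icc (-1:ℝ) 1).Nonempty := ⟨_, _, hm1, rfl⟩
  have hM : ∀ x ∈ Set.Icc (-1:ℝ) 1, w x ≤ sSup (w '' Set.Icc (-1:ℝ) 1) :=
    fun x hx => le_csSup hcomp.bddAbove ⟨x, hx, rfl⟩
  have hm : ∀ x ∈ Set.Icc (-1:ℝ) 1, sInf (w '' Set.Icc (-1:ℝ) 1) ≤ w x :=
    fun x hx => csInf_le hcomp.bddBelow ⟨x, hx, rfl⟩
  have hmpos : 0 < sInf (w '' Set.Icc (-1:ℝ) 1) := by
    obtain ⟨x, hx, hxe⟩ := hcomp.sInf_mem hne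
    rw [← hxe]; exact hw_pos x hx
  generalize sSup (w '' Set.Icc (-1:ℝ) 1) = M at *
  generalize sInf (w '' Set.Icc (-1:ℝ) 1) = m at *
  have hint : ∀ a ∈ Set.Icc (-1:ℝ) 1, ∀ b ∈ Set.Icc (-1:ℝ) 1,
      IntervalIntegrable w volume a b := fun a ha b hb =>
    (hw_cont.mono (Set.uIcc_subset_Icc ha hb)).intervalIntegrable
  have hlow : ∀ a ∈ Set.Icc (-1:ℝ) 1, ∀ b ∈ Set.Icc (-1:ℝ) 1, a ≤ b →
      m * (b - a) ≤ ∫ θ in a..b, w θ := by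
    intro a ha b hb hab
    have := intervalIntegral.integral_mono_on (f := fun _ => m) (g := w) hab
      intervalIntegrable_const (hint a ha b hb)
      (fun x hx => hm x ⟨ha.1.trans hx.1, hx.2.trans hb.2⟩)
    rw [intervalIntegral.integral_const, smul_eq_mul] at this
    linarith
  have hup : ∫ θ in (-1:ℝ)..ℓ, w θ ≤ M * (ℓ + 1) := by
    have := intervalIntegral.integral_mono_on (f := w) (g := fun _ => M) hℓ.1
      (hint _ hm1 _ hℓ') intervalIntegrable_const
      (fun x hx => hM x ⟨hx.1, hx.2.trans hℓ'.2⟩)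
    rw [intervalIntegral.integral_const, smul_eq_mul] at this
    linarith
  have hI0 : 0 ≤ ∫ θ in (-1:ℝ)..ℓ, w θ :=
    le_trans (mul_nonneg hmpos.le (by linarith [hℓ.1])) (hlow _ hm1 _ hℓ' hℓ.1)
  have hadd := intervalIntegral.integral_add_adjacent_intervals
    (hint _ hm1 _ hℓ') (hint _ hℓ' _ hgl)
  have hδI : ∫ θ in ℓ..(g ℓ), w θ = δ * ∫ θ in (-1:ℝ)..ℓ, w θ := by
    have := h1 ℓ hℓ
    linarith
  have hkey : m * |g ℓ - ℓ| ≤ |∫ θ in ℓ..(g ℓ), w θ| := by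
    rcases le_total ℓ (g ℓ) with h | h
    · rw [abs_of_nonneg (sub_nonneg.2 h)]
      exact (hlow _ hℓ' _ hgl h).trans (le_abs_self _)
    · rw [abs_of_nonpos (sub_nonpos.2 h), intervalIntegral.integral_symm, abs_neg, neg_sub]
      exact (hlow _ hgl _ hℓ' h).trans (le_abs_self _)
  rw [hδI, abs_mul, abs_of_nonneg hI0] at hkey
  have h2 := mul_le_mul_of_nonneg_left hup (abs_nonneg δ)
  rw [← mul_div_assoc, le_div_iff₀ hmpos]
  linarith
end
end

section
/- Let w : [−1,1] → ℝ be continuous, strictly positive, and even, let δ ∈ (−1,1), and let g be a δ-rebalancing of w. Then g is differentiable on (−1,0) and on (0,1), with g'(ℓ) = (1+δ)·w(ℓ)/w(g(ℓ)) for every ℓ ∈ (−1,0) and g'(ℓ) = (1−δ)·w(ℓ)/w(g(ℓ)) for every ℓ ∈ (0,1). -/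
open MeasureTheory Set

noncomputable section

open Filter Topology in
/-- Differentiating `F ∘ g = G` when `F` is locally invertible. -/
theorem deriv_of_comp_eq {F G g : ℝ → ℝ} {x a b : ℝ} (hF : HasStrictDerivAt F a (g x))
    (ha : a ≠ 0) (hG : HasDerivAt G b x) (hg : ContinuousAt g x)
    (h : ∀ᶠ y in 𝓝 x, G y = F (g y)) : HasDerivAt g (b / a) x := by
  have hinv := (hF.hasStrictFDerivAt_equiv ha).eventually_left_inverse
  have hH := (hF.to_localInverse ha).hasDerivAt
  rw [← h.self_of_nhds] at hH
  have hc := hH.comp x hG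
  have e : b / a = a⁻¹ * b := by ring
  rw [e]
  refine hc.congr_of_eventuallyEq ?_
  filter_upwards [h, hg.eventually hinv] with y h1 h2
  simp only [Function.comp]
  rw [h1]
  exact h2.symm

theorem stmt_11 (w : ℝ → ℝ) (hw_cont : ContinuousOn w (Set.Icc (-1:ℝ) 1))
    (hw_pos : ∀ θ ∈ Set.Icc (-1:ℝ) 1, 0 < w θ)
    (hw_even : ∀ θ ∈ Set.Icc (-1:ℝ) 1, w (-θ) = w θ)
    (δ : ℝ) (hδ : δ ∈ Set.Ioo (-1:ℝ) 1)
    (g : ℝ → ℝ) (hg : IsRebalancing w δ g) :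
    (∀ ℓ ∈ Set.Ioo (-1:ℝ) 0, HasDerivAt g ((1 + δ) * w ℓ / w (g ℓ)) ℓ) ∧
    (∀ ℓ ∈ Set.Ioo (0:ℝ) 1, HasDerivAt g ((1 - δ) * w ℓ / w (g ℓ)) ℓ) := by
  obtain ⟨hmono, hbij, h1, h2, hl, hr⟩ := hg
  have hca : ∀ x ∈ Set.Ioo (-1:ℝ) 1, ContinuousAt w x := fun x hx =>
    hw_cont.continuousAt (Icc_mem_nhds hx.1 hx.2)
  have hm : ∀ x ∈ Set.Ioo (-1:ℝ) 1, StronglyMeasurableAtFilter w (nhds x) :=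
    fun x hx => ContinuousAt.stronglyMeasurableAtFilter isOpen_Ioo hca x hx
  have hint : ∀ a ∈ Set.Icc (-1:ℝ) 1, ∀ b ∈ Set.Icc (-1:ℝ) 1, IntervalIntegrable w volume a b :=
    fun a ha b hb => (hw_cont.mono (Set.uIcc_subset_Icc ha hb)).intervalIntegrable
  have m1 : (-1:ℝ) ∈ Set.Icc (-1:ℝ) 1 := by norm_num
  have m2 : (1:ℝ) ∈ Set.Icc (-1:ℝ) 1 := by norm_num
  have hR : ∀ x ∈ Set.Ioo (-1:ℝ) 1, HasStrictDerivAt (fun u => ∫ θ in (-1:ℝ)..u, w θ) (w x) x :=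
    fun x hx => intervalIntegral.integral_hasStrictDerivAt_right
      (hint _ m1 _ (Ioo_subset_Icc_self hx)) (hm x hx) (hca x hx)
  have hL : ∀ x ∈ Set.Ioo (-1:ℝ) 1, HasStrictDerivAt (fun u => ∫ θ in u..(1:ℝ), w θ) (-w x) x :=
    fun x hx => intervalIntegral.integral_hasStrictDerivAt_left
      (hint _ (Ioo_subset_Icc_self hx) _ m2) (hm x hx) (hca x hx)
  have hgm : ∀ x ∈ Set.Ioo (-1:ℝ) 1, g x ∈ Set.Ioo (-1:ℝ) 1 := fun x hx =>
    ⟨by simpa [h1] using hmono m1 (Ioo_subset_Icc_self hx) hx.1,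
     by simpa [h2] using hmono (Ioo_subset_Icc_self hx) m2 hx.2⟩
  have hgc : ∀ x ∈ Set.Ioo (-1:ℝ) 1, ContinuousAt g x := fun x hx =>
    hmono.continuousAt_of_image_mem_nhds (Icc_mem_nhds hx.1 hx.2)
      (by rw [hbij.image_eq]; exact Icc_mem_nhds (hgm x hx).1 (hgm x hx).2)
  constructor
  · intro x hx
    have hx' : x ∈ Set.Ioo (-1:ℝ) 1 := ⟨hx.1, by linarith [hx.2]⟩
    have hp := hw_pos _ (Ioo_subset_Icc_self (hgm x hx'))
    refine deriv_of_comp_eq (hR _ (hgm x hx')) hp.ne'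
      ((hR x hx').hasDerivAt.const_mul (1 + δ)) (hgc x hx') ?_
    filter_upwards [Icc_mem_nhds hx.1 hx.2] with y hy using hl y hy
  · intro x hx
    have hx' : x ∈ Set.Ioo (-1:ℝ) 1 := ⟨by linarith [hx.1], hx.2⟩
    have hp := hw_pos _ (Ioo_subset_Icc_self (hgm x hx'))
    have e : (1 - δ) * w x / w (g x) = (1 - δ) * (-w x) / (-w (g x)) := by
      rw [mul_neg, neg_div_neg_eq]
    rw [e]
    refine deriv_of_comp_eq (hL _ (hgm x hx')) (neg_ne_zero.mpr hp.ne')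
      ((hL x hx').hasDerivAt.const_mul (1 - δ)) (hgc x hx') ?_
    filter_upwards [Icc_mem_nhds hx.1 hx.2] with y hy using hr y hy
end
end

section
/- There exists a function h : [0,1/2) → [0,∞) with the following properties: (1) h(r) = 0 for all r ≤ 1/10 (in particular h(0) = 0); (2) h(r) → ∞ as r → 1/2⁻; (3) h is weakly increasing; (4) h is thrice continuously differentiable on [0,1/2), and there is a constant c > 0 such that (h'(r))² ≤ c·(r+h(r))³, h''(r)·h'(r) ≤ c·(r+h(r))³, and |h'''(r)| ≤ c·(r+h(r))² for all r ∈ [0,1/2). -/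
open Set Filter

noncomputable section

def pp (r : ℝ) : ℝ := max 0 (r - 1/10)

def tt (r : ℝ) : ℝ := (1/2 - r)⁻¹

lemma pp_cont : Continuous pp := by unfold pp; fun_prop

lemma pp_nonneg (r : ℝ) : 0 ≤ pp r := le_max_left _ _

lemma pp_deriv (n : ℕ) (r : ℝ) :
    HasDerivAt (fun x => pp x ^ (n+2)) ((n+2 : ℝ) * pp r ^ (n+1)) r := by
  have key : ∀ y : ℝ, y ≠ 1/10 →
      HasDerivAt (fun x => pp x ^ (n+2)) ((n+2 : ℝ) * pp y ^ (n+1)) y := by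
    intro y hy
    rcases lt_or_gt_of_ne hy with h | h
    · have e : (fun x => pp x ^ (n+2)) =ᶠ[nhds y] fun _ => (0:ℝ) := by
        filter_upwards [Iio_mem_nhds h] with x hx
        have : pp x = 0 := max_eq_left (by simp only [mem_Iio] at hx; linarith)
        simp [this]
      have : pp y = 0 := max_eq_left (by linarith)
      rw [this]
      simpa using (hasDerivAt_const y (0:ℝ)).congr_of_eventuallyEq e
    · have e : (fun x => pp x ^ (n+2)) =ᶠ[nhds y] fun x => (x - 1/10) ^ (n+2) := by
        filter_upwards [Ioi_mem_nhds h] with x hx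
        have : pp x = x - 1/10 := max_eq_right (by simp only [mem_Ioi] at hx; linarith)
        simp [this]
      have : pp y = y - 1/10 := max_eq_right (by linarith)
      rw [this]
      have := (((hasDerivAt_id y).sub_const (1/10)).pow (n+2)).congr_of_eventuallyEq e
      simpa using this
  by_cases hr : r = 1/10
  · subst hr
    refine hasDerivAt_of_hasDerivAt_of_ne (g := fun y => (n+2 : ℝ) * pp y ^ (n+1)) key ?_ ?_
    · exact (pp_cont.pow _).continuousAt
    · exact (continuous_const.mul (pp_cont.pow _)).continuousAt
  · exact key r hr

lemma pp_contDiff (n : ℕ) : ContDiff ℝ n (fun x => pp x ^ (n+1)) := by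
  induction n with
  | zero => simpa using pp_cont
  | succ n ih =>
    push_cast
    rw [contDiff_succ_iff_deriv]
    refine ⟨fun x => (pp_deriv n x).differentiableAt, by simp, ?_⟩
    have : deriv (fun x => pp x ^ (n+1+1)) = fun x => (n+2 : ℝ) * pp x ^ (n+1) :=
      funext fun x => (pp_deriv n x).deriv
    rw [this]
    exact contDiff_const.mul ih

lemma tt_deriv (n : ℕ) (r : ℝ) (hr : r < 1/2) :
    HasDerivAt (fun x => tt x ^ (n+1)) ((n+1 : ℝ) * tt r ^ (n+2)) r := by
  have h0 : (1/2 - r) ≠ 0 := by linarith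
  have := ((((hasDerivAt_id r).const_sub (1/2)).inv h0).pow (n+1))
  refine this.congr_deriv ?_
  simp only [tt, Pi.inv_apply, id, Nat.add_sub_cancel, neg_neg, one_div (_ ^ 2), ← inv_pow]
  push_cast
  ring

lemma pt_deriv (m n : ℕ) (r : ℝ) (hr : r < 1/2) :
    HasDerivAt (fun x => pp x ^ (m+2) * tt x ^ (n+1))
      ((m+2 : ℝ) * pp r ^ (m+1) * tt r ^ (n+1) + pp r ^ (m+2) * ((n+1 : ℝ) * tt r ^ (n+2))) r :=
  (pp_deriv m r).mul (tt_deriv n r hr)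

def h0 (r : ℝ) : ℝ := pp r ^ 4 * tt r ^ 3
def h1 (r : ℝ) : ℝ := 4 * (pp r ^ 3 * tt r ^ 3) + 3 * (pp r ^ 4 * tt r ^ 4)
def h2 (r : ℝ) : ℝ := 12 * (pp r ^ 2 * tt r ^ 3) + 24 * (pp r ^ 3 * tt r ^ 4)
  + 12 * (pp r ^ 4 * tt r ^ 5)
def h3 (r : ℝ) : ℝ := 24 * (pp r * tt r ^ 3) + 108 * (pp r ^ 2 * tt r ^ 4)
  + 144 * (pp r ^ 3 * tt r ^ 5) + 60 * (pp r ^ 4 * tt r ^ 6)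

lemma d1 (r : ℝ) (hr : r < 1/2) : deriv h0 r = h1 r := by
  have := (pt_deriv 2 2 r hr).deriv
  refine Eq.trans this ?_
  simp only [h1]; push_cast; ring

lemma d2 (r : ℝ) (hr : r < 1/2) : deriv (deriv h0) r = h2 r := by
  have e : deriv h0 =ᶠ[nhds r] h1 := by
    filter_upwards [Iio_mem_nhds hr] with x hx using d1 x hx
  rw [e.deriv_eq]
  have := (((pt_deriv 1 2 r hr).const_mul 4).add ((pt_deriv 2 3 r hr).const_mul 3)).deriv
  refine Eq.trans this ?_
  simp only [h2]; push_cast; ring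

lemma d3 (r : ℝ) (hr : r < 1/2) : deriv (deriv (deriv h0)) r = h3 r := by
  have e : deriv (deriv h0) =ᶠ[nhds r] h2 := by
    filter_upwards [Iio_mem_nhds hr] with x hx using d2 x hx
  rw [e.deriv_eq]
  have := ((((pt_deriv 0 2 r hr).const_mul 12).add ((pt_deriv 1 3 r hr).const_mul 24)).add
    ((pt_deriv 2 4 r hr).const_mul 12)).deriv
  refine Eq.trans this ?_
  simp only [h3]; push_cast; ring

lemma pt_bound (p t : ℝ) (hp : 0 ≤ p) (hp1 : p ≤ 1) (ht : 1 ≤ t) (m n k : ℕ) (hnk : n ≤ k) :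
    p ^ m * t ^ n ≤ t ^ k :=
  calc p ^ m * t ^ n ≤ 1 * t ^ n := by
        gcongr
        exact pow_le_one₀ hp hp1
    _ = t ^ n := one_mul _
    _ ≤ t ^ k := pow_le_pow_right₀ ht hnk

lemma low (r : ℝ) (h : 1/10 ≤ r) (hr : r < 1/2) : tt r ^ 3 ≤ 1250 * (r + h0 r) := by
  have hs : 0 < 1/2 - r := by linarith
  have e : pp r = r - 1/10 := max_eq_right (by linarith)
  have ht : 0 < tt r := inv_pos.2 hs
  have hst : (1/2 - r) * tt r = 1 := mul_inv_cancel₀ hs.ne'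
  have key : 1 ≤ 1250 * (r * (1/2 - r)^3 + (r - 1/10)^4) := by
    by_cases hc : r ≤ 3/10
    · have h1 : (1/5:ℝ)^3 ≤ (1/2 - r)^3 := by gcongr; linarith
      have h2 : (1/10:ℝ) * (1/5)^3 ≤ r * (1/2-r)^3 := by gcongr
      have h3 : 0 ≤ (r - 1/10)^4 := by positivity
      linarith
    · have h1 : (1/5:ℝ)^4 ≤ (r - 1/10)^4 := by gcongr; linarith
      have h2 : 0 ≤ r * (1/2-r)^3 := by positivity
      linarith
  have := mul_le_mul_of_nonneg_right key (pow_pos ht 3).le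
  rw [h0, e]
  have e3 : (1/2 - r)^3 * tt r ^ 3 = 1 := by rw [← mul_pow, hst, one_pow]
  have e4 : 1250 * (r * (1/2 - r)^3 + (r - 1/10)^4) * tt r ^ 3
      = 1250 * (r * ((1/2 - r)^3 * tt r ^ 3) + (r - 1/10)^4 * tt r ^ 3) := by ring
  rw [e4, e3] at this
  linarith

theorem stmt_12 :
    ∃ h : ℝ → ℝ,
      (∀ r ∈ Set.Ico (0:ℝ) (1/2), 0 ≤ h r) ∧
      (∀ r ∈ Set.Icc (0:ℝ) (1/10), h r = 0) ∧
      Filter.Tendsto h (nhdsWithin (1/2 : ℝ) (Set.Iio (1/2 : ℝ))) Filter.atTop ∧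
      MonotoneOn h (Set.Ico (0:ℝ) (1/2)) ∧
      ContDiffOn ℝ 3 h (Set.Ico (0:ℝ) (1/2)) ∧
      ∃ c : ℝ, 0 < c ∧ ∀ r ∈ Set.Ico (0:ℝ) (1/2),
        (deriv h r) ^ 2 ≤ c * (r + h r) ^ 3 ∧
        deriv (deriv h) r * deriv h r ≤ c * (r + h r) ^ 3 ∧
        |deriv (deriv (deriv h)) r| ≤ c * (r + h r) ^ 2 := by
  have tpos : ∀ r : ℝ, r < 1/2 → 0 < tt r := fun r hr => inv_pos.2 (by linarith)
  have hnn : ∀ r : ℝ, r < 1/2 → 0 ≤ h0 r := fun r hr =>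
    mul_nonneg (pow_nonneg (pp_nonneg r) _) (pow_nonneg (tpos r hr).le _)
  have pz : ∀ r : ℝ, r ≤ 1/10 → pp r = 0 := fun r hr => max_eq_left (by linarith)
  refine ⟨h0, fun r hr => hnn r hr.2, ?_, ?_, ?_, ?_, 336 * 1250 ^ 3, by norm_num, ?_⟩
  · intro r hr
    simp [h0, pz r hr.2]
  · have ht : Tendsto tt (nhdsWithin (1/2 : ℝ) (Set.Iio (1/2 : ℝ))) atTop := by
      refine Filter.Tendsto.inv_tendsto_nhdsGT_zero ?_
      rw [tendsto_nhdsWithin_iff]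
      constructor
      · have : Continuous fun x : ℝ => 1/2 - x := by fun_prop
        have := this.tendsto (1/2)
        simp only [sub_self] at this
        exact this.mono_left nhdsWithin_le_nhds
      · filter_upwards [self_mem_nhdsWithin] with x hx
        simp only [mem_Iio, mem_Ioi] at *
        linarith
    have ht3 : Tendsto (fun x => tt x ^ 3) (nhdsWithin (1/2 : ℝ) (Set.Iio (1/2 : ℝ))) atTop :=
      (tendsto_pow_atTop (by norm_num)).comp ht
    have hp : Tendsto (fun x => pp x ^ 4) (nhdsWithin (1/2 : ℝ) (Set.Iio (1/2 : ℝ)))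
        (nhds (pp (1/2) ^ 4)) :=
      ((pp_cont.pow 4).tendsto _).mono_left nhdsWithin_le_nhds
    refine Tendsto.pos_mul_atTop ?_ hp ht3
    have : 0 < pp (1/2) := lt_max_of_lt_right (by norm_num)
    positivity
  · intro x hx y hy hxy
    have a1 : pp x ≤ pp y := max_le_max le_rfl (by linarith)
    have a2 : tt x ≤ tt y := inv_anti₀ (by linarith [hy.2]) (by linarith)
    have := pp_nonneg x
    have := tpos x hx.2
    have := pp_nonneg y
    unfold h0
    gcongr
  · refine (pp_contDiff 3).contDiffOn.mul (ContDiffOn.pow (ContDiffOn.inv ?_ ?_) 3)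
    · exact (contDiff_const.sub contDiff_id).contDiffOn
    · intro x hx
      have := hx.2
      have : 0 < 1/2 - x := by linarith
      exact this.ne'
  · intro r hr
    rw [d3 r hr.2, d2 r hr.2, d1 r hr.2]
    have hh := hnn r hr.2
    have hr0 := hr.1
    have hr2 := hr.2
    by_cases hc : r ≤ 1/10
    · simp only [h1, h2, h3, pz r hc]
      norm_num
      refine ⟨?_, ?_⟩ <;> positivity
    · push Not at hc
      have hl := low r hc.le hr.2
      have hp := pp_nonneg r
      have hp1 : pp r ≤ 1 := max_le (by norm_num) (by linarith)
      have ht : 1 ≤ tt r := (one_le_inv₀ (by linarith)).2 (by linarith)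
      have ht0 : 0 < tt r := by linarith
      have B := pt_bound (pp r) (tt r) hp hp1 ht
      have b1 : h1 r ≤ 7 * tt r ^ 4 := by
        unfold h1
        linarith [B 3 3 4 (by norm_num), B 4 4 4 (by norm_num)]
      have b2 : h2 r ≤ 48 * tt r ^ 5 := by
        unfold h2
        linarith [B 2 3 5 (by norm_num), B 3 4 5 (by norm_num), B 4 5 5 (by norm_num)]
      have b3 : h3 r ≤ 336 * tt r ^ 6 := by
        unfold h3
        have := B 1 3 6 (by norm_num)
        rw [pow_one] at this
        linarith [B 2 4 6 (by norm_num), B 3 5 6 (by norm_num), B 4 6 6 (by norm_num)]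
      have n1 : 0 ≤ h1 r := by unfold h1; positivity
      have n2 : 0 ≤ h2 r := by unfold h2; positivity
      have n3 : 0 ≤ h3 r := by unfold h3; positivity
      have c3 : (tt r ^ 3) ^ 3 ≤ (1250 * (r + h0 r)) ^ 3 := by gcongr
      have c2 : (tt r ^ 3) ^ 2 ≤ (1250 * (r + h0 r)) ^ 2 := by gcongr
      have c89 : tt r ^ 8 ≤ tt r ^ 9 := pow_le_pow_right₀ ht (by norm_num)
      have t9 : 0 < tt r ^ 9 := by positivity
      rw [← pow_mul, mul_pow] at c3 c2
      norm_num only at c3 c2 ⊢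
      refine ⟨?_, ?_, ?_⟩
      · have : h1 r ^ 2 ≤ (7 * tt r ^ 4) ^ 2 := by gcongr
        have e : (7 * tt r ^ 4) ^ 2 = 49 * tt r ^ 8 := by ring
        linarith
      · have : h2 r * h1 r ≤ (48 * tt r ^ 5) * (7 * tt r ^ 4) := by gcongr
        have e : (48 * tt r ^ 5) * (7 * tt r ^ 4) = 336 * tt r ^ 9 := by ring
        linarith
      · rw [abs_of_nonneg n3]
        have : 0 ≤ (r + h0 r) ^ 2 := by positivity
        linarith
end
end

section
/- (Freedman's inequality.) Let (X_n)_{n≥1} be a martingale with respect to a filtration (F_n)_{n≥1} such that |X_{k+1} − X_k| ≤ R almost surely for all k, where R > 0. Let Y_n = Σ_{i=1}^{n−1} E[(X_{i+1} − X_i)² | F_i]. Then for every t > 0 and every σ² > 0, P[∃ n : X_n − X₁ > t and Y_n ≤ σ²] ≤ exp( −t² / (2(σ² + R·t/3)) ). -/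
open MeasureTheory Filter

noncomputable section

lemma aux_exp_bound (y c : ℝ) (hy : |y| ≤ c) (hc : c < 3) :
    Real.exp y ≤ 1 + y + y ^ 2 / (2 * (1 - c / 3)) := by
  have hc0 : 0 ≤ c := (abs_nonneg y).trans hy
  have h1 : HasSum (fun n : ℕ => y ^ n / (n.factorial : ℝ)) (Real.exp y) := by
    have := NormedSpace.expSeries_div_hasSum_exp (𝔸 := ℝ) y
    rwa [← Real.exp_eq_exp_ℝ] at this
  have h2 := (hasSum_nat_add_iff' (f := fun n : ℕ => y ^ n / (n.factorial : ℝ)) 2).mpr h1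
  have h3 : HasSum (fun n : ℕ => y ^ 2 / 2 * (c / 3) ^ n) (y ^ 2 / 2 * (1 - c / 3)⁻¹) :=
    (hasSum_geometric_of_lt_one (by positivity) (by linarith)).mul_left _
  have h4 := hasSum_le (fun n => ?_) h2 h3
  · simp [Finset.sum_range_succ] at h4
    have : y ^ 2 / (2 * (1 - c / 3)) = y ^ 2 / 2 * (1 - c / 3)⁻¹ := by
      rw [div_mul_eq_div_div, div_eq_mul_inv (y ^ 2 / 2)]
    linarith
  · have hf : (2 * 3 ^ n : ℝ) ≤ ((n + 2).factorial : ℝ) := by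
      have := Nat.factorial_mul_pow_le_factorial (m := 2) (n := n)
      rw [add_comm n 2]
      exact_mod_cast this
    have hp : y ^ n ≤ c ^ n :=
      (le_abs_self _).trans (by rw [abs_pow]; exact pow_le_pow_left₀ (abs_nonneg _) hy n)
    calc y ^ (n + 2) / ((n + 2).factorial : ℝ) = y ^ 2 * y ^ n / ((n + 2).factorial : ℝ) := by
          rw [pow_add, mul_comm]
      _ ≤ y ^ 2 * c ^ n / ((n + 2).factorial : ℝ) := by gcongr
      _ ≤ y ^ 2 * c ^ n / (2 * 3 ^ n) := by gcongr
      _ = y ^ 2 / 2 * (c / 3) ^ n := by rw [div_pow]; field_simp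

lemma aux_ville {Ω : Type*} {m0 : MeasurableSpace Ω} {P : Measure Ω}
    [IsProbabilityMeasure P] (F : Filtration ℕ m0) (S : ℕ → Ω → ℝ)
    (hS : Supermartingale S F P) (h0 : ∀ n ω, 0 ≤ S n ω) (c : ℝ) (n : ℕ) :
    c * P.real {ω | ∃ k ≤ n, c ≤ S k ω} + ∫ ω in {ω | ∃ k ≤ n, c ≤ S k ω}ᶜ, S n ω ∂P
      ≤ ∫ ω, S 0 ω ∂P := by
  have hB : ∀ n, MeasurableSet[F n] {ω | c ≤ S n ω} := fun n =>
    (hS.stronglyMeasurable n).measurable measurableSet_Ici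
  have hA : ∀ n, MeasurableSet[F n] {ω | ∃ k ≤ n, c ≤ S k ω} := by
    intro n
    have : {ω | ∃ k ≤ n, c ≤ S k ω} = ⋃ k, ⋃ (_ : k ≤ n), {ω | c ≤ S k ω} := by
      ext ω; simp
    rw [this]
    exact MeasurableSet.iUnion fun k => MeasurableSet.iUnion fun hk => F.mono hk _ (hB k)
  have key : ∀ (A : Set Ω) (_ : MeasurableSet A) (n : ℕ),
      c * P.real (A ∩ {ω | c ≤ S n ω}) + ∫ ω in A ∩ {ω | c ≤ S n ω}ᶜ, S n ω ∂P
        ≤ ∫ ω in A, S n ω ∂P := by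
    intro A hAm n
    have hBm := F.le n _ (hB n)
    have hi := hS.integrable n
    have e := setIntegral_union (μ := P) (f := S n) (s := A ∩ {ω | c ≤ S n ω})
      (t := A ∩ {ω | c ≤ S n ω}ᶜ)
      (disjoint_compl_right.mono Set.inter_subset_right Set.inter_subset_right)
      (hAm.inter hBm.compl) hi.integrableOn hi.integrableOn
    rw [Set.inter_union_compl] at e
    rw [e]
    gcongr
    have := setIntegral_mono_on (μ := P) (f := fun _ => c) (g := S n) (s := A ∩ {ω | c ≤ S n ω})
      (integrable_const _).integrableOn hi.integrableOn (hAm.inter hBm) (fun ω h => h.2)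
    simpa [mul_comm] using this
  induction n with
  | zero =>
    have := key Set.univ MeasurableSet.univ 0
    simpa using this
  | succ n ih =>
    have hAn := F.le n _ (hA n)
    have k1 := key _ hAn.compl (n + 1)
    have hs := hS.setIntegral_le (Nat.le_succ n) (hA n).compl
    have e1 : {ω | ∃ k ≤ n + 1, c ≤ S k ω} = {ω | ∃ k ≤ n, c ≤ S k ω} ∪
        ({ω | ∃ k ≤ n, c ≤ S k ω}ᶜ ∩ {ω | c ≤ S (n + 1) ω}) := by
      ext ω
      simp only [Set.union_compl_self, Set.univ_inter,
        Set.mem_union, Set.mem_ofPred_eq, Set.union_inter_distrib_left]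
      constructor
      · rintro ⟨k, hk, h⟩
        rcases Nat.lt_or_ge n k with hlt | hge
        · obtain rfl : k = n + 1 := by omega
          exact Or.inr h
        · exact Or.inl ⟨k, hge, h⟩
      · rintro (⟨k, hk, h⟩ | h)
        · exact ⟨k, by omega, h⟩
        · exact ⟨n + 1, le_rfl, h⟩
    have e2 : {ω | ∃ k ≤ n + 1, c ≤ S k ω}ᶜ =
        {ω | ∃ k ≤ n, c ≤ S k ω}ᶜ ∩ {ω | c ≤ S (n + 1) ω}ᶜ := by
      rw [e1]; ext ω; simp only [Set.mem_compl_iff, Set.mem_union, Set.mem_inter_iff]; tauto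
    rw [e2, e1, measureReal_union (disjoint_compl_right.mono_right Set.inter_subset_left)
      (hAn.compl.inter (F.le _ _ (hB (n + 1)))), mul_add]
    linarith

theorem stmt_18 {Ω : Type*} {m0 : MeasurableSpace Ω} {P : Measure Ω}
    [IsProbabilityMeasure P]
    (F : Filtration ℕ m0)
    (X : ℕ → Ω → ℝ) (hX : Martingale X F P)
    (R : ℝ) (hR : 0 < R)
    (hbdd : ∀ k, ∀ᵐ ω ∂P, |X (k + 1) ω - X k ω| ≤ R)
    (t : ℝ) (ht : 0 < t) (σ2 : ℝ) (hσ2 : 0 < σ2) :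
    P {ω | ∃ n, t < X n ω - X 0 ω ∧
        (∑ i ∈ Finset.range n, (P[fun ω' => (X (i + 1) ω' - X i ω') ^ 2|F i]) ω) ≤ σ2}
      ≤ ENNReal.ofReal (Real.exp (-(t ^ 2) / (2 * (σ2 + R * t / 3)))) := by
  have hd : 0 < σ2 + R * t / 3 := by positivity
  set l : ℝ := t / (σ2 + R * t / 3) with hl
  have hl0 : 0 < l := by positivity
  have hlR : 1 - l * R / 3 = σ2 / (σ2 + R * t / 3) := by rw [hl]; field_simp; ring
  have hlR3 : l * R < 3 := by
    have : 0 < σ2 / (σ2 + R * t / 3) := by positivity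
    linarith
  set φ : ℝ := l * t / (2 * σ2) with hφ
  have hφ0 : 0 < φ := by positivity
  have hφeq : l ^ 2 / (2 * (1 - l * R / 3)) = φ := by
    rw [hlR, hφ, hl]; field_simp
  set V : ℕ → Ω → ℝ := fun i => P[fun ω' => (X (i + 1) ω' - X i ω') ^ 2|F i] with hV
  set S : ℕ → Ω → ℝ := fun n ω =>
    Real.exp (l * (X n ω - X 0 ω) - φ * ∑ i ∈ Finset.range n, V i ω) with hSdef
  have hVm : ∀ i, StronglyMeasurable[F i] (V i) := fun i => stronglyMeasurable_condExp
  have hV0 : ∀ i, ∀ᵐ ω ∂P, 0 ≤ V i ω := fun i =>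
    condExp_nonneg (ae_of_all _ fun ω => sq_nonneg _)
  have hXm : ∀ i, StronglyMeasurable[F i] (X i) := hX.stronglyMeasurable
  have hXm0 : ∀ i, StronglyMeasurable (X i) := fun i => (hXm i).mono (F.le i)
  have hSm : ∀ n, StronglyMeasurable[F n] (S n) := by
    intro n
    have hsum : Measurable[F n] (fun ω => ∑ i ∈ Finset.range n, V i ω) :=
      Finset.measurable_fun_sum _ fun i hi =>
        ((hVm i).mono (F.mono (Finset.mem_range.mp hi).le)).measurable
    have hx0 := ((hXm 0).mono (F.mono (Nat.zero_le n))).measurable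
    have hxn := (hXm n).measurable
    exact (Real.measurable_exp.comp
      (((hxn.sub hx0).const_mul l).sub (hsum.const_mul φ))).stronglyMeasurable
  have hXb : ∀ n : ℕ, ∀ᵐ ω ∂P, X n ω - X 0 ω ≤ n * R := by
    intro n
    filter_upwards [ae_all_iff.mpr hbdd] with ω h
    induction n with
    | zero => simp
    | succ n ih =>
      have := (abs_le.mp (h n)).2
      push_cast
      linarith
  have hSi : ∀ n, Integrable (S n) P := by
    intro n
    refine Integrable.of_bound ((hSm n).mono (F.le n)).aestronglyMeasurable
      (Real.exp (l * (n * R))) ?_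
    filter_upwards [hXb n, ae_all_iff.mpr hV0] with ω h1 h2
    rw [Real.norm_eq_abs, Real.abs_exp]
    apply Real.exp_le_exp.mpr
    have : 0 ≤ φ * ∑ i ∈ Finset.range n, V i ω :=
      mul_nonneg hφ0.le (Finset.sum_nonneg fun i _ => h2 i)
    have := mul_le_mul_of_nonneg_left h1 hl0.le
    linarith
  have hsuper : Supermartingale S F P := by
    refine supermartingale_nat hSm hSi fun n => ?_
    set D : Ω → ℝ := fun ω => X (n + 1) ω - X n ω with hD
    have hDm : Measurable D := (hXm0 (n + 1)).measurable.sub (hXm0 n).measurable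
    have hDi : Integrable D P := (hX.integrable (n + 1)).sub (hX.integrable n)
    have hD2i : Integrable (fun ω => D ω ^ 2) P := by
      refine Integrable.of_bound (hDm.pow_const 2).aestronglyMeasurable (R ^ 2) ?_
      filter_upwards [hbdd n] with ω h
      rw [Real.norm_eq_abs, abs_pow]
      exact pow_le_pow_left₀ (abs_nonneg _) h 2
    set g : Ω → ℝ := fun ω => Real.exp (l * D ω) with hg
    have hgi : Integrable g P := by
      refine Integrable.of_bound
        (Real.measurable_exp.comp (hDm.const_mul l)).aestronglyMeasurable (Real.exp (l * R)) ?_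
      filter_upwards [hbdd n] with ω h
      rw [Real.norm_eq_abs, Real.abs_exp]
      exact Real.exp_le_exp.mpr (mul_le_mul_of_nonneg_left (abs_le.mp h).2 hl0.le)
    set f : Ω → ℝ := fun ω => S n ω * Real.exp (-(φ * V n ω)) with hf
    have hfm : StronglyMeasurable[F n] f :=
      (hSm n).mul (Real.measurable_exp.comp
        ((hVm n).measurable.const_mul φ).neg).stronglyMeasurable
    have hfg : S (n + 1) = f * g := by
      funext ω
      simp only [hf, hg, hD, hSdef, Pi.mul_apply, ← Real.exp_add, Finset.sum_range_succ]
      congr 1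
      ring
    have hpull : P[S (n + 1)|F n] =ᵐ[P] f * P[g|F n] := by
      have := hSi (n + 1)
      rw [hfg] at this ⊢
      exact condExp_mul_of_stronglyMeasurable_left hfm this hgi
    have hDce : P[D|F n] =ᵐ[P] 0 := by
      have h1 : P[D|F n] =ᵐ[P] P[X (n + 1)|F n] - P[X n|F n] :=
        condExp_sub (hX.integrable (n + 1)) (hX.integrable n) (F n)
      filter_upwards [h1, hX.condExp_ae_eq (Nat.le_succ n), hX.condExp_ae_eq (le_refl n)]
        with ω a b c
      rw [a, Pi.sub_apply, b, c]; simp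
    have hmono : P[g|F n] ≤ᵐ[P] P[(fun _ => (1 : ℝ)) + (l • D + φ • fun ω => D ω ^ 2)|F n] := by
      refine condExp_mono hgi
        ((integrable_const _).add ((hDi.smul l).add (hD2i.smul φ))) ?_
      filter_upwards [hbdd n] with ω h
      have := aux_exp_bound (l * D ω) (l * R)
        (by rw [abs_mul, abs_of_pos hl0]; exact mul_le_mul_of_nonneg_left h hl0.le) hlR3
      have e : (l * D ω) ^ 2 / (2 * (1 - l * R / 3)) = φ * D ω ^ 2 := by
        rw [← hφeq]; ring
      simp only [Pi.add_apply, Pi.smul_apply, smul_eq_mul, hg]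
      linarith
    have hlin : P[(fun _ => (1 : ℝ)) + (l • D + φ • fun ω => D ω ^ 2)|F n] =ᵐ[P]
        fun ω => 1 + φ * V n ω := by
      have h1 := condExp_add (μ := P) (integrable_const (1 : ℝ))
        ((hDi.smul l).add (hD2i.smul φ)) (F n)
      have h2 := condExp_add (hDi.smul l) (hD2i.smul φ) (F n)
      have h3 := condExp_smul (μ := P) l D (F n)
      have h4 := condExp_smul (μ := P) φ (fun ω => D ω ^ 2) (F n)
      filter_upwards [h1, h2, h3, h4, hDce] with ω a1 a2 a3 a4 a5
      rw [a1, Pi.add_apply, a2, Pi.add_apply, a3, a4, Pi.smul_apply, Pi.smul_apply, a5,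
        condExp_const (F.le n)]
      simp [hV, hD]
    filter_upwards [hpull, hmono, hlin] with ω a b c
    rw [a, Pi.mul_apply]
    rw [c] at b
    have h1 : (P[g|F n]) ω ≤ Real.exp (φ * V n ω) :=
      b.trans (by linarith [Real.add_one_le_exp (φ * V n ω)])
    have hf0 : 0 ≤ f ω := mul_nonneg (Real.exp_pos _).le (Real.exp_pos _).le
    calc f ω * (P[g|F n]) ω ≤ f ω * Real.exp (φ * V n ω) := mul_le_mul_of_nonneg_left h1 hf0
      _ = S n ω := by
        simp only [hf]
        rw [mul_assoc, ← Real.exp_add]; simp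
  set c : ℝ := Real.exp (l * t - φ * σ2) with hc
  have hS0 : ∀ n ω, 0 ≤ S n ω := fun n ω => (Real.exp_pos _).le
  have hfin : ∀ n, P {ω | ∃ k ≤ n, c ≤ S k ω} ≤ ENNReal.ofReal c⁻¹ := by
    intro n
    have h := aux_ville F S hsuper hS0 c n
    have h1 : 0 ≤ ∫ ω in {ω | ∃ k ≤ n, c ≤ S k ω}ᶜ, S n ω ∂P :=
      integral_nonneg fun ω => hS0 n ω
    have h2 : ∫ ω, S 0 ω ∂P = 1 := by simp [hSdef]
    have h3 : P.real {ω | ∃ k ≤ n, c ≤ S k ω} ≤ c⁻¹ := by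
      rw [← one_div, le_div_iff₀ (Real.exp_pos _)]
      linarith
    rw [← ofReal_measureReal]
    exact ENNReal.ofReal_le_ofReal h3
  have hcinv : c⁻¹ = Real.exp (-(t ^ 2) / (2 * (σ2 + R * t / 3))) := by
    rw [hc, ← Real.exp_neg]
    congr 1
    rw [hφ, hl]; field_simp; ring
  rw [← hcinv]
  have hsub : {ω | ∃ n, t < X n ω - X 0 ω ∧ (∑ i ∈ Finset.range n, V i ω) ≤ σ2} ⊆
      ⋃ n, {ω | ∃ k ≤ n, c ≤ S k ω} := by
    rintro ω ⟨n, h1, h2⟩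
    refine Set.mem_iUnion.mpr ⟨n, n, le_rfl, Real.exp_le_exp.mpr ?_⟩
    have := mul_le_mul_of_nonneg_left h1.le hl0.le
    have := mul_le_mul_of_nonneg_left h2 hφ0.le
    linarith
  refine (measure_mono hsub).trans ?_
  rw [Monotone.measure_iUnion]
  · exact iSup_le hfin
  · rintro a b hab ω ⟨k, hk, h⟩
    exact ⟨k, hk.trans hab, h⟩
end
end
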